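/- arXiv:2408.07963 — 11 statements merged into one kernel-verified Lean document; each statement's English description precedes it below -/
import Mathlib

section
/- For all z ∈ ℂ, the determinant of the parametrised matrix A(z) satisfies det A(z) = (z − κt t)(z − κt^{-1} t)(z − κ1)(z − κ1^{-1}). -/
open Matrix

theorem stmt_0 (κ0 κt κ1 κi t f g w : ℂ)
    (hκ0 : κ0 ≠ 0) (hκt : κt ≠ 0) (hκ1 : κ1 ≠ 0) (hκi : κi ≠ 0) (ht : t ≠ 0)
    (hf : f ≠ 0) (hg : g ≠ 0) (hw : w ≠ 0) (hκi2 : κi ^ 2 ≠ 1)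
    (g1 g2 α β γ δ : ℂ)
    (hg1 : g1 = κi⁻¹ * (f - κt * t) * (f - κt⁻¹ * t) * g⁻¹)
    (hg2 : g2 = κi * (f - κ1) * (f - κ1⁻¹) * g)
    (hα : α = (κi ^ 2 * g1 - κi * (κ0 + κ0⁻¹) * t + g2 + ((κt + κt⁻¹) * t + (κ1 + κ1⁻¹)) * f
        - 2 * f ^ 2) / ((1 - κi ^ 2) * f))
    (hβ : β = (κi ^ 2 * g1 - κi * (κ0 + κ0⁻¹) * t + g2 + κi ^ 2 * ((κt + κt⁻¹) * t + (κ1 + κ1⁻¹)) * f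
        - 2 * κi ^ 2 * f ^ 2) / ((κi ^ 2 - 1) * f))
    (hγ : γ = g1 + g2 + f ^ 2 + 2 * (α + β) * f + α * β - (t ^ 2 + (κt + κt⁻¹) * (κ1 + κ1⁻¹) * t + 1))
    (hδ : δ = f⁻¹ * (t ^ 2 - (g1 + α * f) * (g2 + β * f)))
    (A : ℂ → Matrix (Fin 2) (Fin 2) ℂ)
    (hA : ∀ z : ℂ, A z = !![κi * ((z - f) * (z - α) + g1), κi⁻¹ * w * (z - f);
                            κi * w⁻¹ * (γ * z + δ), κi⁻¹ * ((z - f) * (z - β) + g2)]) :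
    ∀ z : ℂ, (A z).det = (z - κt * t) * (z - κt⁻¹ * t) * (z - κ1) * (z - κ1⁻¹) := by
  have expand_target : ∀ z : ℂ, (z - κt * t) * (z - κt⁻¹ * t) * (z - κ1) * (z - κ1⁻¹)
      = z ^ 4 - ((κt + κt⁻¹) * t + (κ1 + κ1⁻¹)) * z ^ 3
        + (t ^ 2 + (κt + κt⁻¹) * (κ1 + κ1⁻¹) * t + 1) * z ^ 2
        - ((κt + κt⁻¹) * t + (κ1 + κ1⁻¹) * t ^ 2) * z + t ^ 2 := by
    intro z
    field_simp
    ring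
  have g1_mul_g2 : g1 * g2 = (f - κt * t) * (f - κt⁻¹ * t) * (f - κ1) * (f - κ1⁻¹) := by
    rw [hg1, hg2]
    field_simp
  have α_add_β : α + β = ((κt + κt⁻¹) * t + (κ1 + κ1⁻¹)) - 2 * f := by
    have h1 : 1 - κi ^ 2 ≠ 0 := sub_ne_zero.mpr hκi2.symm
    rw [hα, hβ, ← neg_sub (1 : ℂ) (κi ^ 2), neg_mul, div_neg, ← sub_eq_add_neg, ← sub_div,
      div_eq_iff (mul_ne_zero h1 hf)]
    ring
  have f_mul_δ : f * δ = t ^ 2 - (g1 + α * f) * (g2 + β * f) := by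
    rw [hδ, mul_inv_cancel_left₀ hf]
  intro z
  have det_eq : (A z).det
      = ((z - f) * (z - α) + g1) * ((z - f) * (z - β) + g2) - (z - f) * (γ * z + δ) := by
    rw [hA, det_fin_two_of]
    field_simp
  rw [det_eq, expand_target]
  rw [expand_target] at g1_mul_g2
  apply mul_left_cancel₀ hf
  linear_combination (z * f ^ 3 - z ^ 3 * f) * α_add_β + (z * f ^ 2 - z ^ 2 * f) * hγ
    + (f - z) * f_mul_δ + z * g1_mul_g2
end

section
/- The parametrised matrix A(z) evaluated at z = 0 satisfies trace A(0) = A(0)_{11} + A(0)_{22} = t(κ0 + κ0^{-1}) and det A(0) = t^2; in particular, if κ0^2 ≠ 1, the matrix A(0) has eigenvalues κ0 t and κ0^{-1} t. -/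
open Matrix

/-- The roots of the characteristic polynomial of a `2 × 2` matrix are its eigenvalues. -/
theorem hasEigenvalue_toLin'_of_trace_det {K : Type*} [Field K] (M : Matrix (Fin 2) (Fin 2) K)
    (μ : K) (h : μ ^ 2 - M.trace * μ + M.det = 0) :
    Module.End.HasEigenvalue (Matrix.toLin' M) μ := by
  rw [Module.End.hasEigenvalue_iff_isRoot_charpoly, Matrix.charpoly_toLin', Matrix.charpoly_fin_two]
  simpa [Polynomial.IsRoot] using h

theorem stmt_1 (κ0 κt κ1 κi t f g w : ℂ)
    (hκ0 : κ0 ≠ 0) (hκt : κt ≠ 0) (hκ1 : κ1 ≠ 0) (hκi : κi ≠ 0) (ht : t ≠ 0)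
    (hf : f ≠ 0) (hg : g ≠ 0) (hw : w ≠ 0) (hκi2 : κi ^ 2 ≠ 1)
    (g1 g2 α β γ δ : ℂ)
    (hg1 : g1 = κi⁻¹ * (f - κt * t) * (f - κt⁻¹ * t) * g⁻¹)
    (hg2 : g2 = κi * (f - κ1) * (f - κ1⁻¹) * g)
    (hα : α = (κi ^ 2 * g1 - κi * (κ0 + κ0⁻¹) * t + g2 + ((κt + κt⁻¹) * t + (κ1 + κ1⁻¹)) * f
        - 2 * f ^ 2) / ((1 - κi ^ 2) * f))
    (hβ : β = (κi ^ 2 * g1 - κi * (κ0 + κ0⁻¹) * t + g2 + κi ^ 2 * ((κt + κt⁻¹) * t + (κ1 + κ1⁻¹)) * f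
        - 2 * κi ^ 2 * f ^ 2) / ((κi ^ 2 - 1) * f))
    (hγ : γ = g1 + g2 + f ^ 2 + 2 * (α + β) * f + α * β - (t ^ 2 + (κt + κt⁻¹) * (κ1 + κ1⁻¹) * t + 1))
    (hδ : δ = f⁻¹ * (t ^ 2 - (g1 + α * f) * (g2 + β * f)))
    (A : ℂ → Matrix (Fin 2) (Fin 2) ℂ)
    (hA : ∀ z : ℂ, A z = !![κi * ((z - f) * (z - α) + g1), κi⁻¹ * w * (z - f);
                            κi * w⁻¹ * (γ * z + δ), κi⁻¹ * ((z - f) * (z - β) + g2)]) :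
    (A 0).trace = t * (κ0 + κ0⁻¹) ∧ (A 0).det = t ^ 2 ∧
      (κ0 ^ 2 ≠ 1 →
        Module.End.HasEigenvalue (Matrix.toLin' (A 0)) (κ0 * t) ∧
        Module.End.HasEigenvalue (Matrix.toLin' (A 0)) (κ0⁻¹ * t)) := by
  have hK : 1 - κi ^ 2 ≠ 0 := sub_ne_zero.mpr hκi2.symm
  have hK' : κi ^ 2 - 1 ≠ 0 := sub_ne_zero.mpr hκi2
  have htr : (A 0).trace = t * (κ0 + κ0⁻¹) := by
    rw [eq_div_iff (mul_ne_zero hK hf)] at hα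
    rw [eq_div_iff (mul_ne_zero hK' hf)] at hβ
    rw [hA, Matrix.trace_fin_two_of]
    apply mul_left_cancel₀ (mul_ne_zero hK hκi)
    linear_combination κi ^ 2 * hα - hβ +
      (1 - κi ^ 2) * ((0 - f) * (0 - β) + g2) * mul_inv_cancel₀ hκi
  have hdet : (A 0).det = t ^ 2 := by
    have hfδ : f * δ = t ^ 2 - (g1 + α * f) * (g2 + β * f) := by
      rw [hδ, mul_inv_cancel_left₀ hf]
    rw [hA, Matrix.det_fin_two_of]
    field_simp
    linear_combination hfδ
  refine ⟨htr, hdet, fun _ => ⟨?_, ?_⟩⟩ <;>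
    apply hasEigenvalue_toLin'_of_trace_det <;> rw [htr, hdet] <;> field_simp <;> ring
end

section
/- Set R∞ = min(|κ∞|^2, |κ∞|^{-2}). For every q ∈ ℂ with 0 < |q| < R∞ there is a unique sequence (V_n(q))_{n ≥ 0} of 2×2 complex matrices with V_0(q) = I such that for all n ≥ 1, q^{-n} V_n(q) K − K V_n(q) = q A1 V_{n−1}(q) + q^2 A0 V_{n−2}(q), where V_{−1}(q) := 0. Moreover, for any 0 < R < R∞, any real α ≥ 1 with ‖A1‖max ≤ α and ‖A0‖max ≤ α^2, and β = min{(1 − R)k, (1 − R)k^{-1}, |k − R k^{-1}|, |k^{-1} − R k|} where k = |κ∞|, one has ‖V_n(q)‖max ≤ (2α/β)^n R^{n(n+6)/4} for all 0 < |q| ≤ R and all n ≥ 0; furthermore, for each fixed n ≥ 1 there is a constant C_n such that ‖V_n(q)‖max ≤ C_n |q|^{⌊n(n+6)/4⌋} for all 0 < |q| ≤ R. -/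
open Matrix

/-- The max-norm of a 2×2 complex matrix: the maximum of the absolute values of its entries. -/
noncomputable def maxNorm (M : Matrix (Fin 2) (Fin 2) ℂ) : ℝ :=
  max (max ‖M 0 0‖ ‖M 0 1‖) (max ‖M 1 0‖ ‖M 1 1‖)

/-- The recurrence `q^{-n} Vₙ K - K Vₙ = q A1 Vₙ₋₁ + q² A0 Vₙ₋₂` (n ≥ 1), with V₀ = I and
V₋₁ = 0, where `K = diag(κ∞, κ∞⁻¹)`. -/
def recSeq (κi q : ℂ) (A0 A1 : Matrix (Fin 2) (Fin 2) ℂ)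
    (V : ℕ → Matrix (Fin 2) (Fin 2) ℂ) : Prop :=
  V 0 = 1 ∧ ∀ n : ℕ,
    q ^ (-((n : ℤ) + 1)) • (V (n + 1) * !![κi, 0; 0, κi⁻¹]) - !![κi, 0; 0, κi⁻¹] * V (n + 1) =
      q • (A1 * V n) + q ^ 2 • (A0 * (if n = 0 then 0 else V (n - 1)))

lemma norm_apply_le_maxNorm (M : Matrix (Fin 2) (Fin 2) ℂ) (i j : Fin 2) :
    ‖M i j‖ ≤ maxNorm M := by
  fin_cases i <;> fin_cases j <;> simp [maxNorm]

lemma maxNorm_nonneg (M : Matrix (Fin 2) (Fin 2) ℂ) : 0 ≤ maxNorm M :=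
  (norm_nonneg _).trans (norm_apply_le_maxNorm M 0 0)

lemma maxNorm_le {M : Matrix (Fin 2) (Fin 2) ℂ} {c : ℝ} (h : ∀ i j, ‖M i j‖ ≤ c) :
    maxNorm M ≤ c :=
  max_le (max_le (h _ _) (h _ _)) (max_le (h _ _) (h _ _))

lemma maxNorm_zero : maxNorm 0 = 0 := by simp [maxNorm]

lemma maxNorm_one : maxNorm 1 = 1 := by simp [maxNorm]

lemma norm_mul_apply_le (A B : Matrix (Fin 2) (Fin 2) ℂ) (i j : Fin 2) :
    ‖(A * B) i j‖ ≤ 2 * (maxNorm A * maxNorm B) := by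
  rw [Matrix.mul_apply, Fin.sum_univ_two]
  have h (l : Fin 2) : ‖A i l * B l j‖ ≤ maxNorm A * maxNorm B := by
    rw [norm_mul]
    exact mul_le_mul (norm_apply_le_maxNorm _ _ _) (norm_apply_le_maxNorm _ _ _)
      (norm_nonneg _) (maxNorm_nonneg _)
  linarith [norm_add_le (A i 0 * B 0 j) (A i 1 * B 1 j), h 0, h 1]

/-- The lower bound for `|K_j - q ^ n K_i|` over all `0 < |q| ≤ R` and `n ≥ 1`, where `k = |κ∞|`. -/
noncomputable def gap (k R : ℝ) : ℝ :=
  min (min ((1 - R) * k) ((1 - R) * k⁻¹)) (min |k - R * k⁻¹| |k⁻¹ - R * k|)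

section Gap

variable {k R : ℝ}

lemma lt_one_of_lt_min (hk : 0 < k) (hR : R < min (k ^ 2) (k⁻¹ ^ 2)) : R < 1 := by
  obtain ⟨h1, h2⟩ := lt_min_iff.1 hR
  rcases le_total k 1 with h | h
  · exact h1.trans_le (pow_le_one₀ hk.le h)
  · exact h2.trans_le (pow_le_one₀ (by positivity) (inv_le_one_of_one_le₀ h))

lemma mul_inv_lt_of_lt_min (hk : 0 < k) (hR : R < min (k ^ 2) (k⁻¹ ^ 2)) : R * k⁻¹ < k := by
  rw [← div_eq_mul_inv, div_lt_iff₀ hk, ← sq]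
  exact (lt_min_iff.1 hR).1

lemma mul_lt_inv_of_lt_min (hk : 0 < k) (hR : R < min (k ^ 2) (k⁻¹ ^ 2)) : R * k < k⁻¹ := by
  have h := mul_inv_lt_of_lt_min (inv_pos.2 hk) (R := R) (by rwa [inv_inv, min_comm])
  rwa [inv_inv] at h

lemma gap_pos (hk : 0 < k) (hR : R < min (k ^ 2) (k⁻¹ ^ 2)) : 0 < gap k R := by
  have h1 := sub_pos.2 (lt_one_of_lt_min hk hR)
  have h2 := sub_pos.2 (mul_inv_lt_of_lt_min hk hR)
  have h3 := sub_pos.2 (mul_lt_inv_of_lt_min hk hR)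
  exact lt_min (lt_min (by positivity) (by positivity))
    (lt_min (abs_pos.2 h2.ne') (abs_pos.2 h3.ne'))

lemma gap_le_one_sub (hk : 0 < k) (hR : R < min (k ^ 2) (k⁻¹ ^ 2)) : gap k R ≤ 1 - R := by
  have h1 := sub_pos.2 (lt_one_of_lt_min hk hR)
  rcases le_total k 1 with h | h
  · exact ((min_le_left _ _).trans (min_le_left _ _)).trans (mul_le_of_le_one_right h1.le h)
  · exact ((min_le_left _ _).trans (min_le_right _ _)).trans
      (mul_le_of_le_one_right h1.le (inv_le_one_of_one_le₀ h))

end Gap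

section Recurrence

variable {κi q : ℂ} {R : ℝ}

lemma gap_le_norm_sub (hκi : κi ≠ 0) (hR : R < min (‖κi‖ ^ 2) (‖κi‖⁻¹ ^ 2)) (hqR : ‖q‖ ≤ R)
    (n : ℕ) (i j : Fin 2) :
    gap ‖κi‖ R ≤ ‖![κi, κi⁻¹] j - q ^ (n + 1) * ![κi, κi⁻¹] i‖ := by
  have hk : 0 < ‖κi‖ := norm_pos_iff.2 hκi
  have hR1 := lt_one_of_lt_min hk hR
  have hpow : ‖q‖ ^ (n + 1) ≤ R :=
    (pow_le_of_le_one (norm_nonneg _) (hqR.trans hR1.le) n.succ_ne_zero).trans hqR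
  have key (a b : ℂ) : ‖a‖ - R * ‖b‖ ≤ ‖a - q ^ (n + 1) * b‖ := by
    refine le_trans ?_ (norm_sub_norm_le _ _)
    rw [norm_mul, norm_pow]
    gcongr
  have h2 := (sub_pos.2 (mul_inv_lt_of_lt_min hk hR)).le
  have h3 := (sub_pos.2 (mul_lt_inv_of_lt_min hk hR)).le
  have hk1 : gap ‖κi‖ R ≤ (1 - R) * ‖κi‖ := (min_le_left _ _).trans (min_le_left _ _)
  have hk2 : gap ‖κi‖ R ≤ (1 - R) * ‖κi‖⁻¹ := (min_le_left _ _).trans (min_le_right _ _)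
  have hk3 : gap ‖κi‖ R ≤ ‖κi‖ - R * ‖κi‖⁻¹ := by
    rw [← abs_of_nonneg h2]; exact (min_le_right _ _).trans (min_le_left _ _)
  have hk4 : gap ‖κi‖ R ≤ ‖κi‖⁻¹ - R * ‖κi‖ := by
    rw [← abs_of_nonneg h3]; exact (min_le_right _ _).trans (min_le_right _ _)
  have e1 := key κi κi
  have e2 := key κi⁻¹ κi⁻¹
  have e3 := key κi κi⁻¹
  have e4 := key κi⁻¹ κi
  simp only [norm_inv] at e2 e3 e4
  fin_cases i <;> fin_cases j <;> simp <;> linarith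

lemma sylvester_apply (X : Matrix (Fin 2) (Fin 2) ℂ) (c : ℂ) (i j : Fin 2) :
    (c • (X * !![κi, 0; 0, κi⁻¹]) - !![κi, 0; 0, κi⁻¹] * X) i j =
      (c * ![κi, κi⁻¹] j - ![κi, κi⁻¹] i) * X i j := by
  fin_cases i <;> fin_cases j <;>
    simp [Matrix.mul_apply, Fin.sum_univ_two, Matrix.vecMul, dotProduct] <;> ring

lemma zpow_mul_sub_eq (hq : q ≠ 0) (n : ℕ) (a b : ℂ) :
    q ^ (-((n : ℤ) + 1)) * a - b = (q ^ (n + 1))⁻¹ * (a - q ^ (n + 1) * b) := by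
  have : q ^ (-((n : ℤ) + 1)) = (q ^ (n + 1))⁻¹ := by
    rw [_root_.zpow_neg]; norm_cast
  rw [this]
  field_simp

lemma sylvester_iff (hκi : κi ≠ 0) (hR : R < min (‖κi‖ ^ 2) (‖κi‖⁻¹ ^ 2)) (hq : 0 < ‖q‖)
    (hqR : ‖q‖ ≤ R) (n : ℕ) (X B : Matrix (Fin 2) (Fin 2) ℂ) :
    q ^ (-((n : ℤ) + 1)) • (X * !![κi, 0; 0, κi⁻¹]) - !![κi, 0; 0, κi⁻¹] * X = B ↔
      X = Matrix.of fun i j ↦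
        q ^ (n + 1) / (![κi, κi⁻¹] j - q ^ (n + 1) * ![κi, κi⁻¹] i) * B i j := by
  have hq0 : q ≠ 0 := norm_pos_iff.1 hq
  rw [← Matrix.ext_iff, ← Matrix.ext_iff]
  refine forall_congr' fun i ↦ forall_congr' fun j ↦ ?_
  have hd : ![κi, κi⁻¹] j - q ^ (n + 1) * ![κi, κi⁻¹] i ≠ 0 := norm_pos_iff.1
    ((gap_pos (norm_pos_iff.2 hκi) hR).trans_le (gap_le_norm_sub hκi hR hqR n i j))
  rw [sylvester_apply, zpow_mul_sub_eq hq0, Matrix.of_apply]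
  generalize ![κi, κi⁻¹] j - q ^ (n + 1) * ![κi, κi⁻¹] i = d at hd
  have hqn : q ^ (n + 1) ≠ 0 := pow_ne_zero _ hq0
  generalize q ^ (n + 1) = p at hqn
  constructor
  · intro h
    rw [← h]
    field_simp
  · intro h
    rw [h]
    field_simp

lemma existsUnique_recSeq (hκi : κi ≠ 0) (A0 A1 : Matrix (Fin 2) (Fin 2) ℂ)
    (hR : R < min (‖κi‖ ^ 2) (‖κi‖⁻¹ ^ 2)) (hq : 0 < ‖q‖) (hqR : ‖q‖ ≤ R) :
    ∃! V : ℕ → Matrix (Fin 2) (Fin 2) ℂ, recSeq κi q A0 A1 V := by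
  simp only [recSeq, sylvester_iff hκi hR hq hqR]
  let F (n : ℕ) (B : Matrix (Fin 2) (Fin 2) ℂ) : Matrix (Fin 2) (Fin 2) ℂ :=
    Matrix.of fun i j ↦ q ^ (n + 1) / (![κi, κi⁻¹] j - q ^ (n + 1) * ![κi, κi⁻¹] i) * B i j
  let P : ℕ → Matrix (Fin 2) (Fin 2) ℂ × Matrix (Fin 2) (Fin 2) ℂ := fun n ↦
    Nat.rec (1, 0) (fun n p ↦ (F n (q • (A1 * p.1) + q ^ 2 • (A0 * p.2)), p.1)) n
  have hP (n : ℕ) : (P n).2 = if n = 0 then 0 else (P (n - 1)).1 := by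
    cases n <;> rfl
  refine ⟨fun n ↦ (P n).1, ⟨rfl, fun n ↦ ?_⟩, ?_⟩
  · rw [← hP n]
  · rintro W ⟨hW0, hW⟩
    funext n
    induction n using Nat.strong_induction_on with
    | _ n ih =>
      cases n with
      | zero => exact hW0
      | succ n =>
        have hprev : (if n = 0 then 0 else W (n - 1)) = (P n).2 := by
          rw [hP]
          split_ifs
          · rfl
          · exact ih _ (by omega)
        rw [hW n, ih n n.lt_succ_self, hprev]

lemma recSeq.maxNorm_succ_le {A0 A1 : Matrix (Fin 2) (Fin 2) ℂ}
    {V : ℕ → Matrix (Fin 2) (Fin 2) ℂ} (hV : recSeq κi q A0 A1 V) (hκi : κi ≠ 0)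
    (hR : R < min (‖κi‖ ^ 2) (‖κi‖⁻¹ ^ 2)) (hq : 0 < ‖q‖) (hqR : ‖q‖ ≤ R) (n : ℕ) :
    maxNorm (V (n + 1)) ≤ ‖q‖ ^ (n + 1) / gap ‖κi‖ R *
      (‖q‖ * (2 * (maxNorm A1 * maxNorm (V n))) +
        ‖q‖ ^ 2 * (2 * (maxNorm A0 * maxNorm (if n = 0 then 0 else V (n - 1))))) := by
  have hg := gap_pos (norm_pos_iff.2 hκi) hR
  refine maxNorm_le fun i j ↦ ?_
  rw [(sylvester_iff hκi hR hq hqR n _ _).1 (hV.2 n), Matrix.of_apply, norm_mul, norm_div, norm_pow]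
  refine mul_le_mul ?_ ?_ (norm_nonneg _) (by positivity)
  · gcongr
    exact gap_le_norm_sub hκi hR hqR n i j
  · rw [Matrix.add_apply, Matrix.smul_apply, Matrix.smul_apply]
    refine (norm_add_le _ _).trans ?_
    rw [norm_smul, norm_smul, norm_pow]
    gcongr <;> exact norm_mul_apply_le _ _ _ _

lemma recSeq.maxNorm_le_pow_mul_rpow {A0 A1 : Matrix (Fin 2) (Fin 2) ℂ}
    {V : ℕ → Matrix (Fin 2) (Fin 2) ℂ} (hV : recSeq κi q A0 A1 V) (hκi : κi ≠ 0)
    (hR : R < min (‖κi‖ ^ 2) (‖κi‖⁻¹ ^ 2)) (hq : 0 < ‖q‖) (hqR : ‖q‖ ≤ R) {α : ℝ} (hα : 0 < α)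
    (hA1 : maxNorm A1 ≤ α) (hA0 : maxNorm A0 ≤ α ^ 2) (n : ℕ) :
    maxNorm (V n) ≤ (2 * α / gap ‖κi‖ R) ^ n * R ^ (((n * (n + 6) : ℕ) : ℝ) / 4) := by
  have hk : 0 < ‖κi‖ := norm_pos_iff.2 hκi
  have hg := gap_pos hk hR
  have hg1 := gap_le_one_sub hk hR
  have hR0 : 0 < R := hq.trans_le hqR
  have hR1 : R < 1 := lt_one_of_lt_min hk hR
  have hstep := hV.maxNorm_succ_le hκi hR hq hqR
  set g := gap ‖κi‖ R
  induction n using Nat.strong_induction_on with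
  | _ n ih =>
    match n with
    | 0 => simp [hV.1, maxNorm_one]
    | 1 =>
      have h := hstep 0
      simp only [hV.1, maxNorm_one, maxNorm_zero, zero_add, if_true, mul_zero, add_zero, mul_one,
        pow_one] at h
      have hpow : R ^ 2 ≤ R ^ (((1 * (1 + 6) : ℕ) : ℝ) / 4) := by
        rw [← Real.rpow_natCast]
        exact Real.rpow_le_rpow_of_exponent_ge hR0 hR1.le (by norm_num)
      calc maxNorm (V 1) ≤ ‖q‖ / g * (‖q‖ * (2 * maxNorm A1)) := h
        _ ≤ R / g * (R * (2 * α)) := by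
            have := maxNorm_nonneg A1
            gcongr
        _ = (2 * α / g) ^ 1 * R ^ 2 := by ring
        _ ≤ _ := by gcongr
    | n + 2 =>
      have h := hstep (n + 1)
      simp only [n.succ_ne_zero, if_false, Nat.add_sub_cancel] at h
      have h1 := ih (n + 1) (by omega)
      have h0 := ih n (by omega)
      set e : ℝ := (((n + 2) * (n + 2 + 6) : ℕ) : ℝ) / 4 with he
      have p1 : R ^ (n + 2) * R * R ^ ((((n + 1) * (n + 1 + 6) : ℕ) : ℝ) / 4)
          ≤ R ^ e * R ^ (3 / 4 : ℝ) := by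
        rw [← pow_succ, ← Real.rpow_natCast, ← Real.rpow_add hR0, ← Real.rpow_add hR0]
        refine Real.rpow_le_rpow_of_exponent_ge hR0 hR1.le ?_
        rw [he]
        push_cast
        nlinarith [(Nat.cast_nonneg n : (0 : ℝ) ≤ n)]
      have p0 : R ^ (n + 2) * R ^ 2 * R ^ (((n * (n + 6) : ℕ) : ℝ) / 4) = R ^ e := by
        rw [← pow_add, ← Real.rpow_natCast, ← Real.rpow_add hR0, he]
        congr 1
        push_cast
        ring
      have hR34 : R ^ (3 / 4 : ℝ) ≤ 1 / 4 + 3 / 4 * R := by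
        have := Real.geom_mean_le_arith_mean2_weighted (w₁ := 1 / 4) (w₂ := 3 / 4)
          (p₁ := 1) (p₂ := R) (by norm_num) (by norm_num) (by norm_num) hR0.le (by norm_num)
        simpa using this
      have hsum : R ^ (3 / 4 : ℝ) + g / 2 ≤ 1 := by linarith
      have hA1' := maxNorm_nonneg A1
      have hA0' := maxNorm_nonneg A0
      have hV1' := maxNorm_nonneg (V (n + 1))
      have hV0' := maxNorm_nonneg (V n)
      calc maxNorm (V (n + 2))
          ≤ _ := h
        _ ≤ R ^ (n + 2) / g *
            (R * (2 * (α * ((2 * α / g) ^ (n + 1) * R ^ ((((n + 1) * (n + 1 + 6) : ℕ) : ℝ) / 4)))) +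
              R ^ 2 * (2 * (α ^ 2 * ((2 * α / g) ^ n * R ^ (((n * (n + 6) : ℕ) : ℝ) / 4))))) := by
            gcongr
        _ = (2 * α / g) ^ (n + 2) *
              (R ^ (n + 2) * R * R ^ ((((n + 1) * (n + 1 + 6) : ℕ) : ℝ) / 4)) +
            (2 * α / g) ^ (n + 2) *
              (R ^ (n + 2) * R ^ 2 * R ^ (((n * (n + 6) : ℕ) : ℝ) / 4)) * (g / 2) := by
            rw [pow_succ (2 * α / g) (n + 1), pow_succ (2 * α / g) n]
            field_simp
        _ ≤ (2 * α / g) ^ (n + 2) * (R ^ e * R ^ (3 / 4 : ℝ)) +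
            (2 * α / g) ^ (n + 2) * R ^ e * (g / 2) := by
            rw [p0]
            gcongr
        _ = (2 * α / g) ^ (n + 2) * R ^ e * (R ^ (3 / 4 : ℝ) + g / 2) := by ring
        _ ≤ (2 * α / g) ^ (n + 2) * R ^ e := mul_le_of_le_one_right (by positivity) hsum

lemma exists_maxNorm_le_mul_pow (hκi : κi ≠ 0) (A0 A1 : Matrix (Fin 2) (Fin 2) ℂ)
    (hR : R < min (‖κi‖ ^ 2) (‖κi‖⁻¹ ^ 2)) (n : ℕ) :
    ∃ C : ℝ, 0 ≤ C ∧ ∀ q : ℂ, ∀ V : ℕ → Matrix (Fin 2) (Fin 2) ℂ, 0 < ‖q‖ → ‖q‖ ≤ R →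
      recSeq κi q A0 A1 V → maxNorm (V n) ≤ C * ‖q‖ ^ (n * (n + 6) / 4) := by
  have hk : 0 < ‖κi‖ := norm_pos_iff.2 hκi
  have hg := gap_pos hk hR
  have hR1 : R < 1 := lt_one_of_lt_min hk hR
  have hA1 := maxNorm_nonneg A1
  have hA0 := maxNorm_nonneg A0
  induction n using Nat.strong_induction_on with
  | _ n ih =>
    match n with
    | 0 => exact ⟨1, zero_le_one, fun q V _ _ hV ↦ by simp [hV.1, maxNorm_one]⟩
    | 1 =>
      refine ⟨2 * maxNorm A1 / gap ‖κi‖ R, by positivity, fun q V hq hqR hV ↦ ?_⟩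
      have h := hV.maxNorm_succ_le hκi hR hq hqR 0
      simp only [hV.1, maxNorm_one, maxNorm_zero, zero_add, if_true, mul_zero, add_zero, mul_one,
        pow_one] at h
      calc maxNorm (V 1) ≤ _ := h
        _ = 2 * maxNorm A1 / gap ‖κi‖ R * ‖q‖ * ‖q‖ := by ring
        _ ≤ 2 * maxNorm A1 / gap ‖κi‖ R * ‖q‖ :=
            mul_le_of_le_one_right (by positivity) (hqR.trans hR1.le)
        _ = _ := by norm_num
    | n + 2 =>
      obtain ⟨C1, hC1, h1⟩ := ih (n + 1) (by omega)
      obtain ⟨C0, hC0, h0⟩ := ih n (by omega)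
      refine ⟨2 * maxNorm A1 / gap ‖κi‖ R * C1 + 2 * maxNorm A0 / gap ‖κi‖ R * C0,
        by positivity, fun q V hq hqR hV ↦ ?_⟩
      have h := hV.maxNorm_succ_le hκi hR hq hqR (n + 1)
      simp only [n.succ_ne_zero, if_false, Nat.add_sub_cancel] at h
      have hV1 := h1 q V hq hqR hV
      have hV0 := h0 q V hq hqR hV
      have hq1 := hqR.trans hR1.le
      have p1 : ‖q‖ ^ (n + 3 + (n + 1) * (n + 1 + 6) / 4) ≤ ‖q‖ ^ ((n + 2) * (n + 2 + 6) / 4) := by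
        refine pow_le_pow_of_le_one hq.le hq1 ?_
        have : (n + 2) * (n + 2 + 6) ≤ (n + 1) * (n + 1 + 6) + 4 * (n + 3) := by nlinarith
        omega
      have p0 : ‖q‖ ^ (n + 4 + n * (n + 6) / 4) = ‖q‖ ^ ((n + 2) * (n + 2 + 6) / 4) := by
        congr 1
        have : (n + 2) * (n + 2 + 6) = n * (n + 6) + 4 * (n + 4) := by ring
        omega
      calc maxNorm (V (n + 2))
          ≤ _ := h
        _ ≤ ‖q‖ ^ (n + 2) / gap ‖κi‖ R *
            (‖q‖ * (2 * (maxNorm A1 * (C1 * ‖q‖ ^ ((n + 1) * (n + 1 + 6) / 4)))) +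
              ‖q‖ ^ 2 * (2 * (maxNorm A0 * (C0 * ‖q‖ ^ (n * (n + 6) / 4))))) := by
            gcongr
        _ = 2 * maxNorm A1 / gap ‖κi‖ R * C1 * ‖q‖ ^ (n + 3 + (n + 1) * (n + 1 + 6) / 4) +
            2 * maxNorm A0 / gap ‖κi‖ R * C0 * ‖q‖ ^ (n + 4 + n * (n + 6) / 4) := by
            rw [pow_add, pow_add ‖q‖ (n + 4)]
            ring
        _ ≤ _ := by
            rw [p0, add_mul (_ * C1)]
            gcongr

end Recurrence

theorem stmt_3 (κi : ℂ) (hκi : κi ≠ 0) (A0 A1 : Matrix (Fin 2) (Fin 2) ℂ)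
    (Rinf : ℝ) (hRinf : Rinf = min (‖κi‖ ^ 2) (‖κi‖⁻¹ ^ 2)) :
    (∀ q : ℂ, 0 < ‖q‖ → ‖q‖ < Rinf →
      ∃! V : ℕ → Matrix (Fin 2) (Fin 2) ℂ, recSeq κi q A0 A1 V) ∧
    (∀ R α β : ℝ, 0 < R → R < Rinf → 1 ≤ α → maxNorm A1 ≤ α → maxNorm A0 ≤ α ^ 2 →
      β = min (min ((1 - R) * ‖κi‖) ((1 - R) * ‖κi‖⁻¹))
          (min |‖κi‖ - R * ‖κi‖⁻¹| |‖κi‖⁻¹ - R * ‖κi‖|) →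
      ∀ q : ℂ, ∀ V : ℕ → Matrix (Fin 2) (Fin 2) ℂ, 0 < ‖q‖ → ‖q‖ ≤ R → recSeq κi q A0 A1 V →
        ∀ n : ℕ, maxNorm (V n) ≤ (2 * α / β) ^ n * R ^ (((n * (n + 6) : ℕ) : ℝ) / 4)) ∧
    (∀ R : ℝ, 0 < R → R < Rinf → ∀ n : ℕ, 1 ≤ n → ∃ C : ℝ,
      ∀ q : ℂ, ∀ V : ℕ → Matrix (Fin 2) (Fin 2) ℂ, 0 < ‖q‖ → ‖q‖ ≤ R → recSeq κi q A0 A1 V →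
        maxNorm (V n) ≤ C * ‖q‖ ^ (n * (n + 6) / 4)) := by
  subst hRinf
  refine ⟨fun q hq hqR ↦ existsUnique_recSeq hκi A0 A1 hqR hq le_rfl, ?_, ?_⟩
  · rintro R α β - hR hα hA1 hA0 rfl q V hq hqR hV n
    exact hV.maxNorm_le_pow_mul_rpow hκi hR hq hqR (zero_lt_one.trans_le hα) hA1 hA0 n
  · intro R _ hR n _
    obtain ⟨C, -, hC⟩ := exists_maxNorm_le_mul_pow hκi A0 A1 hR n
    exact ⟨C, hC⟩
end

section
/- Set R0 = min(|κ0|^2, |κ0|^{-2}). For each q ∈ ℂ with 0 < |q| < R0 there exists a unique entire matrix-valued function Φ_q : ℂ → M_2(ℂ) with Φ_q(0) = H^{-1} satisfying the functional equation Φ_q(z) = t^{-1} K0^{-1} Φ_q(q z) A(z) for all z ∈ ℂ, where K0 = diag(κ0, κ0^{-1}). Moreover, as q → 0 with q ≠ 0, one has Φ_q(z) → t^{-1} K0^{-1} H^{-1} A(z) and Φ_q(q z) → H^{-1}, both locally uniformly in z ∈ ℂ. -/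
open Matrix Filter Topology

section QDifference

variable {𝔸 : Type*} [NormedRing 𝔸]

/-- An entire function grows at most linearly around the origin on each disc. -/
lemma exists_norm_sub_le_mul_norm_of_differentiable {E : Type*} [NormedAddCommGroup E]
    [NormedSpace ℂ E] [CompleteSpace E] {D : ℂ → E} (hD : Differentiable ℂ D) (R : ℝ) :
    ∃ M : ℝ, 0 ≤ M ∧ ∀ z : ℂ, ‖z‖ ≤ R → ‖D z - D 0‖ ≤ M * ‖z‖ := by
  have hcont : Continuous (deriv D) := (hD.contDiff (n := 1)).continuous_deriv le_rfl
  obtain ⟨M, hM⟩ := (isCompact_closedBall (0 : ℂ) R).exists_bound_of_continuousOn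
    hcont.continuousOn
  refine ⟨max M 0, le_max_right _ _, fun z hz => ?_⟩
  have hR : 0 ≤ R := (norm_nonneg z).trans hz
  simpa using (convex_closedBall (0 : ℂ) R).norm_image_sub_le_of_norm_deriv_le (f := D)
    (C := max M 0) (x := 0) (y := z) (fun x _ => hD x)
    (fun x hx => (hM x hx).trans (le_max_left _ _))
    (by simpa using hR) (by simpa using hz)

/-- The operator `F ↦ L * F (q * ·) * B` contracts the weight `‖z‖ * exp (C / (1 - ‖q‖) * ‖z‖)`
by the factor `ρ * ‖q‖`. -/
lemma norm_mul_comp_mul_le {L : 𝔸} {B F : ℂ → 𝔸} {q : ℂ} {R ρ C m : ℝ} (hq : ‖q‖ < 1)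
    (hρ : 0 ≤ ρ) (hm : 0 ≤ m)
    (hB : ∀ z : ℂ, ‖z‖ ≤ R → ‖L‖ * ‖B z‖ ≤ ρ * (1 + C * ‖z‖))
    (hF : ∀ z : ℂ, ‖z‖ ≤ R → ‖F z‖ ≤ m * (‖z‖ * Real.exp (C / (1 - ‖q‖) * ‖z‖)))
    {z : ℂ} (hz : ‖z‖ ≤ R) :
    ‖L * F (q * z) * B z‖ ≤ m * (ρ * ‖q‖) * (‖z‖ * Real.exp (C / (1 - ‖q‖) * ‖z‖)) := by
  have hqz : ‖q * z‖ ≤ R := by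
    rw [norm_mul]
    exact (mul_le_of_le_one_left (norm_nonneg z) hq.le).trans hz
  have hFq := hF _ hqz
  have hq' : 1 - ‖q‖ ≠ 0 := by linarith
  have hexp : Real.exp (C / (1 - ‖q‖) * ‖q * z‖) * (1 + C * ‖z‖)
      ≤ Real.exp (C / (1 - ‖q‖) * ‖z‖) := by
    have heq : C / (1 - ‖q‖) * ‖z‖ = C / (1 - ‖q‖) * ‖q * z‖ + C * ‖z‖ := by
      rw [norm_mul]; field_simp; ring
    rw [heq, Real.exp_add]
    gcongr
    linarith [Real.add_one_le_exp (C * ‖z‖)]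
  calc ‖L * F (q * z) * B z‖ ≤ ‖L‖ * ‖F (q * z)‖ * ‖B z‖ :=
        (norm_mul_le _ _).trans (by gcongr; exact norm_mul_le _ _)
    _ = ‖F (q * z)‖ * (‖L‖ * ‖B z‖) := by ring
    _ ≤ (m * (‖q * z‖ * Real.exp (C / (1 - ‖q‖) * ‖q * z‖))) * (ρ * (1 + C * ‖z‖)) :=
        mul_le_mul hFq (hB z hz) (by positivity) (by positivity)
    _ = m * (ρ * ‖q‖) * (‖z‖ * (Real.exp (C / (1 - ‖q‖) * ‖q * z‖) * (1 + C * ‖z‖))) := by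
        rw [norm_mul]; ring
    _ ≤ _ := by gcongr

/-- A priori bound for solutions of `D z = f z + L * D (q * z) * B z`. -/
lemma norm_le_of_eq_add_mul_comp_mul {L : 𝔸} {B D f : ℂ → 𝔸} {q : ℂ} {R ρ C m M : ℝ}
    (hq : ‖q‖ < 1) (hρ : 0 ≤ ρ) (hρq : ρ * ‖q‖ < 1) (hC : 0 ≤ C) (hm : 0 ≤ m) (hM : 0 ≤ M)
    (hB : ∀ z : ℂ, ‖z‖ ≤ R → ‖L‖ * ‖B z‖ ≤ ρ * (1 + C * ‖z‖))
    (hf : ∀ z : ℂ, ‖z‖ ≤ R → ‖f z‖ ≤ m * ‖z‖)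
    (hD : ∀ z : ℂ, ‖z‖ ≤ R → ‖D z‖ ≤ M * ‖z‖)
    (hfD : ∀ z : ℂ, D z = f z + L * D (q * z) * B z) {z : ℂ} (hz : ‖z‖ ≤ R) :
    ‖D z‖ ≤ m / (1 - ρ * ‖q‖) * (‖z‖ * Real.exp (C / (1 - ‖q‖) * ‖z‖)) := by
  have hq' : 0 < 1 - ‖q‖ := by linarith
  have hr' : 0 < 1 - ρ * ‖q‖ := by linarith
  have hw : ∀ z : ℂ, ‖z‖ ≤ ‖z‖ * Real.exp (C / (1 - ‖q‖) * ‖z‖) := fun z =>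
    le_mul_of_one_le_right (norm_nonneg z) (Real.one_le_exp (by positivity))
  have hiter : ∀ (n : ℕ) (z : ℂ), ‖z‖ ≤ R →
      ‖D z‖ ≤ (m / (1 - ρ * ‖q‖) + M * (ρ * ‖q‖) ^ n) *
        (‖z‖ * Real.exp (C / (1 - ‖q‖) * ‖z‖)) := by
    intro n
    induction n with
    | zero =>
      intro z hz
      have h0 : 0 ≤ m / (1 - ρ * ‖q‖) := by positivity
      refine (hD z hz).trans (mul_le_mul ?_ (hw z) (norm_nonneg z) (by positivity))
      simpa using h0
    | succ n ih =>
      intro z hz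
      have hstep := norm_mul_comp_mul_le hq hρ (by positivity) hB ih hz
      have hfz : ‖f z‖ ≤ m * (‖z‖ * Real.exp (C / (1 - ‖q‖) * ‖z‖)) :=
        (hf z hz).trans (by gcongr; exact hw z)
      calc ‖D z‖ ≤ ‖f z‖ + ‖L * D (q * z) * B z‖ := by
            conv_lhs => rw [hfD z]
            exact norm_add_le _ _
        _ ≤ _ := add_le_add hfz hstep
        _ = _ := by
            have hm' : m / (1 - ρ * ‖q‖) = m + m / (1 - ρ * ‖q‖) * (ρ * ‖q‖) := by
              field_simp; ring
            rw [pow_succ]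
            linear_combination -(‖z‖ * Real.exp (C / (1 - ‖q‖) * ‖z‖)) * hm'
  have hlim : Tendsto (fun n : ℕ => (m / (1 - ρ * ‖q‖) + M * (ρ * ‖q‖) ^ n) *
      (‖z‖ * Real.exp (C / (1 - ‖q‖) * ‖z‖))) atTop
      (𝓝 ((m / (1 - ρ * ‖q‖) + M * 0) * (‖z‖ * Real.exp (C / (1 - ‖q‖) * ‖z‖)))) :=
    (((tendsto_pow_atTop_nhds_zero_of_lt_one (by positivity) hρq).const_mul M).const_add
      _).mul_const _
  simpa using ge_of_tendsto' hlim fun n => hiter n z hz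

variable [NormedAlgebra ℂ 𝔸] [CompleteSpace 𝔸]

lemma exists_norm_mul_norm_le_of_differentiable {L : 𝔸} {B : ℂ → 𝔸} {ρ : ℝ} (hρ : 0 < ρ)
    (hB : Differentiable ℂ B) (hLB : ‖L‖ * ‖B 0‖ ≤ ρ) (R : ℝ) :
    ∃ C : ℝ, 0 ≤ C ∧ ∀ z : ℂ, ‖z‖ ≤ R → ‖L‖ * ‖B z‖ ≤ ρ * (1 + C * ‖z‖) := by
  obtain ⟨M, hM0, hM⟩ := exists_norm_sub_le_mul_norm_of_differentiable hB R
  refine ⟨‖L‖ * M / ρ, by positivity, fun z hz => ?_⟩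
  have hBz : ‖B z‖ ≤ ‖B 0‖ + M * ‖z‖ := by
    linarith [hM z hz, norm_le_norm_add_norm_sub' (B z) (B 0)]
  calc ‖L‖ * ‖B z‖ ≤ ‖L‖ * (‖B 0‖ + M * ‖z‖) := by gcongr
    _ = ‖L‖ * ‖B 0‖ + ‖L‖ * M * ‖z‖ := by ring
    _ ≤ ρ + ‖L‖ * M * ‖z‖ := by gcongr
    _ = _ := by field_simp

/-- Entire solutions of `Ψ z = L * Ψ (q * z) * B z` with a prescribed value at `0` are unique. -/
lemma eq_of_eq_mul_comp_mul {L : 𝔸} {B Ψ₁ Ψ₂ : ℂ → 𝔸} {ρ : ℝ} {q : ℂ} (hρ : 0 < ρ)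
    (hB : Differentiable ℂ B) (hLB : ‖L‖ * ‖B 0‖ ≤ ρ) (hq : ‖q‖ < 1) (hρq : ρ * ‖q‖ < 1)
    (hd₁ : Differentiable ℂ Ψ₁) (hd₂ : Differentiable ℂ Ψ₂) (h0 : Ψ₁ 0 = Ψ₂ 0)
    (h₁ : ∀ z, Ψ₁ z = L * Ψ₁ (q * z) * B z) (h₂ : ∀ z, Ψ₂ z = L * Ψ₂ (q * z) * B z) :
    Ψ₁ = Ψ₂ := by
  funext z
  obtain ⟨C, hC0, hC⟩ := exists_norm_mul_norm_le_of_differentiable hρ hB hLB ‖z‖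
  obtain ⟨M, hM0, hM⟩ := exists_norm_sub_le_mul_norm_of_differentiable (hd₁.sub hd₂) ‖z‖
  have := norm_le_of_eq_add_mul_comp_mul (D := Ψ₁ - Ψ₂) (f := fun _ => 0) (m := 0)
    hq hρ.le hρq hC0 le_rfl hM0 hC (by simp) (by simpa [h0] using hM)
    (fun z => by
      rw [Pi.sub_apply, Pi.sub_apply, h₁ z, h₂ z, zero_add, mul_sub, sub_mul]) le_rfl
  rw [← sub_eq_zero, ← norm_le_zero_iff]
  simpa using this

/-- Bound for entire solutions near the origin, uniform in small `q`. -/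
lemma exists_norm_sub_one_le_of_eq_mul_comp_mul {L : 𝔸} {B : ℂ → 𝔸} {ρ : ℝ} (hρ : 0 < ρ)
    (hB : Differentiable ℂ B) (hLB : ‖L‖ * ‖B 0‖ ≤ ρ) (hLB1 : L * B 0 = 1) (R : ℝ) :
    ∃ N : ℝ, 0 ≤ N ∧ ∀ (q : ℂ) (Ψ : ℂ → 𝔸), ‖q‖ ≤ 1 / 2 → ρ * ‖q‖ ≤ 1 / 2 →
      Differentiable ℂ Ψ → Ψ 0 = 1 → (∀ z, Ψ z = L * Ψ (q * z) * B z) →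
      ∀ z : ℂ, ‖z‖ ≤ R → ‖Ψ z - 1‖ ≤ N * ‖z‖ := by
  obtain ⟨C, hC0, hC⟩ := exists_norm_mul_norm_le_of_differentiable hρ hB hLB R
  obtain ⟨m, hm0, hm⟩ := exists_norm_sub_le_mul_norm_of_differentiable (hB.const_mul L) R
  refine ⟨2 * m * Real.exp (2 * C * R), by positivity, fun q Ψ hq hρq hd h0 h z hz => ?_⟩
  obtain ⟨M, hM0, hM⟩ := exists_norm_sub_le_mul_norm_of_differentiable hd R
  have key := norm_le_of_eq_add_mul_comp_mul (D := fun z => Ψ z - 1)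
    (f := fun z => L * B z - 1) (hq.trans_lt one_half_lt_one) hρ.le
    (hρq.trans_lt one_half_lt_one) hC0 hm0 hM0 hC
    (by simpa [hLB1] using hm) (by simpa [h0] using hM)
    (fun z => by
      conv_lhs => rw [h z]
      noncomm_ring) hz
  refine key.trans ?_
  have h1 : m / (1 - ρ * ‖q‖) ≤ 2 * m := by
    rw [div_le_iff₀ (by linarith)]
    nlinarith
  have h2 : C / (1 - ‖q‖) ≤ 2 * C := by
    rw [div_le_iff₀ (by linarith)]
    nlinarith
  calc m / (1 - ρ * ‖q‖) * (‖z‖ * Real.exp (C / (1 - ‖q‖) * ‖z‖))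
      ≤ 2 * m * (‖z‖ * Real.exp (2 * C * R)) := by gcongr
    _ = _ := by ring

/-- Existence of entire solutions of `Ψ z = L * Ψ (q * z) * B z`, as the sum of the
iterates of the operator on the right applied to `L * B - 1`. -/
lemma exists_differentiable_eq_mul_comp_mul {L : 𝔸} {B : ℂ → 𝔸} {ρ : ℝ} {q : ℂ} (hρ : 0 < ρ)
    (hB : Differentiable ℂ B) (hLB : ‖L‖ * ‖B 0‖ ≤ ρ) (hLB1 : L * B 0 = 1)
    (hq : ‖q‖ < 1) (hρq : ρ * ‖q‖ < 1) :
    ∃ Ψ : ℂ → 𝔸, Differentiable ℂ Ψ ∧ Ψ 0 = 1 ∧ ∀ z, Ψ z = L * Ψ (q * z) * B z := by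
  let g : ℕ → ℂ → 𝔸 := fun n =>
    (fun F z => L * F (q * z) * B z)^[n] fun z => L * B z - 1
  have hg0 : ∀ z, g 0 z = L * B z - 1 := fun z => rfl
  have hg : ∀ n z, g (n + 1) z = L * g n (q * z) * B z := fun n z => by
    simp only [g, Function.iterate_succ_apply']
  have hgd : ∀ n, Differentiable ℂ (g n) := by
    intro n
    induction n with
    | zero => exact (hB.const_mul L).sub_const 1
    | succ n ih =>
      rw [show g (n + 1) = fun z => L * g n (q * z) * B z from funext (hg n)]
      exact ((ih.comp (differentiable_id.const_mul q)).const_mul L).mul hB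
  have hgz : ∀ n, g n 0 = 0 := by
    intro n
    induction n with
    | zero => simp [hg0, hLB1]
    | succ n ih => simp [hg, ih]
  have hbound : ∀ R : ℝ, ∃ u : ℕ → ℝ, Summable u ∧ ∀ n z, ‖z‖ ≤ R → ‖g n z‖ ≤ u n := by
    intro R
    obtain ⟨C, hC0, hC⟩ := exists_norm_mul_norm_le_of_differentiable hρ hB hLB R
    obtain ⟨m, hm0, hm⟩ := exists_norm_sub_le_mul_norm_of_differentiable (hB.const_mul L) R
    have hq' : 0 < 1 - ‖q‖ := by linarith
    have hgn : ∀ n z, ‖z‖ ≤ R → ‖g n z‖ ≤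
        m * (ρ * ‖q‖) ^ n * (‖z‖ * Real.exp (C / (1 - ‖q‖) * ‖z‖)) := by
      intro n
      induction n with
      | zero =>
        intro z hz
        rw [hg0, pow_zero, mul_one]
        have h1 : ‖L * B z - 1‖ ≤ m * ‖z‖ := by simpa [hLB1] using hm z hz
        refine h1.trans ?_
        exact mul_le_mul_of_nonneg_left (le_mul_of_one_le_right (norm_nonneg z)
          (Real.one_le_exp (by positivity))) hm0
      | succ n ih =>
        intro z hz
        rw [hg, pow_succ, ← mul_assoc m]
        exact norm_mul_comp_mul_le hq hρ.le (by positivity) hC ih hz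
    refine ⟨fun n => m * (ρ * ‖q‖) ^ n * (R * Real.exp (C / (1 - ‖q‖) * R)),
      ((summable_geometric_of_lt_one (by positivity) hρq).mul_left m).mul_right _,
      fun n z hz => (hgn n z hz).trans ?_⟩
    have hR : 0 ≤ R := (norm_nonneg z).trans hz
    beta_reduce
    gcongr
  have hsum : ∀ z, Summable fun n => g n z := fun z => by
    obtain ⟨u, hu, hgu⟩ := hbound ‖z‖
    exact Summable.of_norm_bounded hu fun n => hgu n z le_rfl
  refine ⟨fun z => 1 + ∑' n, g n z, ?_, by simp [hgz], fun z => ?_⟩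
  · refine Differentiable.const_add 1 fun z => ?_
    obtain ⟨u, hu, hgu⟩ := hbound (‖z‖ + 1)
    refine (Complex.differentiableOn_tsum_of_summable_norm (U := Metric.ball 0 (‖z‖ + 1)) hu
      (fun n => (hgd n).differentiableOn) Metric.isOpen_ball
      (fun n w hw => hgu n w (by simpa using (mem_ball_zero_iff.mp hw).le))).differentiableAt
      (Metric.isOpen_ball.mem_nhds (by simp))
  · have hs := ((hsum (q * z)).hasSum.mul_left L).mul_right (B z)
    simp only [← hg] at hs
    beta_reduce
    rw [(hsum z).tsum_eq_zero_add, hs.tsum_eq, hg0]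
    noncomm_ring

/-- As `q → 0`, entire solutions of `Ψ z = L * Ψ (q * z) * B z` with value `1` at the origin
satisfy `Ψ (q * z) → 1` and `Ψ z → L * B z`, locally uniformly. -/
lemma tendstoLocallyUniformly_of_eq_mul_comp_mul {L : 𝔸} {B : ℂ → 𝔸} {Ψ : ℂ → ℂ → 𝔸} {ρ : ℝ}
    (hρ : 0 < ρ) (hB : Differentiable ℂ B) (hLB : ‖L‖ * ‖B 0‖ ≤ ρ) (hLB1 : L * B 0 = 1)
    (hΨ : ∀ᶠ q in 𝓝[≠] (0 : ℂ), Differentiable ℂ (Ψ q) ∧ Ψ q 0 = 1 ∧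
      ∀ z, Ψ q z = L * Ψ q (q * z) * B z) (P : 𝔸) :
    TendstoLocallyUniformly (fun q z => Ψ q z * P) (fun z => L * B z * P) (𝓝[≠] (0 : ℂ)) ∧
      TendstoLocallyUniformly (fun q z => Ψ q (q * z) * P) (fun _ => P) (𝓝[≠] (0 : ℂ)) := by
  have hlim : ∀ c : ℝ, Tendsto (fun q : ℂ => c * ‖q‖) (𝓝[≠] 0) (𝓝 0) := fun c => by
    have : Tendsto (fun q : ℂ => c * ‖q‖) (𝓝[≠] 0) (𝓝 (c * ‖(0 : ℂ)‖)) :=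
      ((continuous_const.mul continuous_norm).tendsto 0).mono_left nhdsWithin_le_nhds
    simpa using this
  have hbound : ∀ R : ℝ, ∃ N : ℝ, 0 ≤ N ∧ ∀ᶠ q in 𝓝[≠] (0 : ℂ), ∀ z : ℂ, ‖z‖ ≤ R →
      ‖Ψ q (q * z) - 1‖ ≤ N * R * ‖q‖ := by
    intro R
    obtain ⟨N, hN0, hN⟩ := exists_norm_sub_one_le_of_eq_mul_comp_mul hρ hB hLB hLB1 R
    have hsmall : ∀ c : ℝ, ∀ᶠ q in 𝓝[≠] (0 : ℂ), c * ‖q‖ ≤ 1 / 2 := fun c =>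
      (hlim c).eventually_le_const (by norm_num)
    refine ⟨N, hN0, ?_⟩
    filter_upwards [hΨ, hsmall 1, hsmall ρ] with q ⟨hd, h0, h⟩ hq1 hqρ z hz
    rw [one_mul] at hq1
    have hqz : ‖q * z‖ ≤ ‖q‖ * R := by
      rw [norm_mul]; gcongr
    have hR : 0 ≤ R := (norm_nonneg z).trans hz
    calc ‖Ψ q (q * z) - 1‖ ≤ N * ‖q * z‖ :=
          hN q _ hq1 hqρ hd h0 h _ (hqz.trans (by nlinarith))
      _ ≤ N * (‖q‖ * R) := by gcongr
      _ = _ := by ring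
  have hnhds : ∀ x : ℂ, Metric.closedBall 0 (‖x‖ + 1) ∈ 𝓝 x := fun x =>
    mem_of_superset (Metric.isOpen_ball.mem_nhds (by simp)) Metric.ball_subset_closedBall
  constructor
  · rw [Metric.tendstoLocallyUniformly_iff]
    intro ε hε x
    obtain ⟨N, hN0, hN⟩ := hbound (‖x‖ + 1)
    obtain ⟨b, hb⟩ := (isCompact_closedBall (0 : ℂ) (‖x‖ + 1)).exists_bound_of_continuousOn
      hB.continuous.continuousOn
    refine ⟨_, hnhds x, ?_⟩
    filter_upwards [hΨ, hN, (hlim (‖L‖ * (N * (‖x‖ + 1)) * b * ‖P‖)).eventually_lt_const hε]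
      with q ⟨_, _, h⟩ hq hqε z hz
    have hz' := hq z (by simpa using hz)
    rw [dist_comm, dist_eq_norm]
    calc ‖Ψ q z * P - L * B z * P‖ = ‖L * (Ψ q (q * z) - 1) * B z * P‖ := by
          rw [h z]; congr 1; noncomm_ring
      _ ≤ ‖L‖ * ‖Ψ q (q * z) - 1‖ * ‖B z‖ * ‖P‖ := by
          refine (norm_mul_le _ _).trans ?_
          gcongr
          refine (norm_mul_le _ _).trans ?_
          gcongr
          exact norm_mul_le _ _
      _ ≤ ‖L‖ * (N * (‖x‖ + 1) * ‖q‖) * b * ‖P‖ := by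
          gcongr
          exact hb z hz
      _ = ‖L‖ * (N * (‖x‖ + 1)) * b * ‖P‖ * ‖q‖ := by ring
      _ < ε := hqε
  · rw [Metric.tendstoLocallyUniformly_iff]
    intro ε hε x
    obtain ⟨N, hN0, hN⟩ := hbound (‖x‖ + 1)
    refine ⟨_, hnhds x, ?_⟩
    filter_upwards [hN, (hlim (N * (‖x‖ + 1) * ‖P‖)).eventually_lt_const hε] with q hq hqε z hz
    have hz' := hq z (by simpa using hz)
    rw [dist_comm, dist_eq_norm]
    calc ‖Ψ q (q * z) * P - P‖ = ‖(Ψ q (q * z) - 1) * P‖ := by rw [sub_mul, one_mul]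
      _ ≤ ‖Ψ q (q * z) - 1‖ * ‖P‖ := norm_mul_le _ _
      _ ≤ N * (‖x‖ + 1) * ‖q‖ * ‖P‖ := by gcongr
      _ = N * (‖x‖ + 1) * ‖P‖ * ‖q‖ := by ring
      _ < ε := hqε

end QDifference

section LinftyOp

attribute [local instance] Matrix.linftyOpNormedRing Matrix.linftyOpNormedAlgebra

lemma differentiable_matrix_iff {n : Type*} [Fintype n] [DecidableEq n]
    {Φ : ℂ → Matrix n n ℂ} :
    Differentiable ℂ Φ ↔ ∀ i j, Differentiable ℂ fun z => Φ z i j := by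
  refine ⟨fun h i j => ?_, fun h => ?_⟩
  · exact (LinearMap.toContinuousLinearMap (Matrix.entryLinearMap ℂ ℂ i j)).differentiable.comp h
  · have hsum : Φ = fun z => ∑ i, ∑ j, Φ z i j • Matrix.single i j (1 : ℂ) := by
      funext z
      conv_lhs => rw [Matrix.matrix_eq_sum_single (Φ z)]
      simp
    rw [hsum]
    fun_prop

lemma norm_diagonal_fin_two_le {a b : ℂ} {s : ℝ} (ha : ‖a‖ ≤ s) (hb : ‖b‖ ≤ s) :
    ‖(!![a, 0; 0, b] : Matrix (Fin 2) (Fin 2) ℂ)‖ ≤ s := by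
  have : (!![a, 0; 0, b] : Matrix (Fin 2) (Fin 2) ℂ) = diagonal ![a, b] := by
    ext i j; fin_cases i <;> fin_cases j <;> simp
  rw [this, Matrix.linfty_opNorm_diagonal, pi_norm_le_iff_of_nonneg ((norm_nonneg a).trans ha)]
  intro i
  fin_cases i <;> simpa

end LinftyOp

theorem stmt_6 (κ0 t : ℂ) (hκ0 : κ0 ≠ 0) (ht : t ≠ 0)
    (H : Matrix (Fin 2) (Fin 2) ℂ) (hH : IsUnit H)
    (A0 A1 A2 : Matrix (Fin 2) (Fin 2) ℂ)
    (hA0 : A0 = H * !![κ0 * t, 0; 0, κ0⁻¹ * t] * H⁻¹)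
    (A : ℂ → Matrix (Fin 2) (Fin 2) ℂ)
    (hA : ∀ z : ℂ, A z = A0 + z • A1 + z ^ 2 • A2)
    (R0 : ℝ) (hR0 : R0 = min (‖κ0‖ ^ 2) (‖κ0‖⁻¹ ^ 2)) :
    (∀ q : ℂ, 0 < ‖q‖ → ‖q‖ < R0 →
      ∃! Φ : ℂ → Matrix (Fin 2) (Fin 2) ℂ,
        (∀ i j : Fin 2, Differentiable ℂ fun z => Φ z i j) ∧ Φ 0 = H⁻¹ ∧
          ∀ z : ℂ, Φ z = t⁻¹ • ((!![κ0, 0; 0, κ0⁻¹])⁻¹ * (Φ (q * z) * A z))) ∧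
    (∀ Φ : ℂ → ℂ → Matrix (Fin 2) (Fin 2) ℂ,
      (∀ q : ℂ, 0 < ‖q‖ → ‖q‖ < R0 →
        (∀ i j : Fin 2, Differentiable ℂ fun z => Φ q z i j) ∧ Φ q 0 = H⁻¹ ∧
          ∀ z : ℂ, Φ q z = t⁻¹ • ((!![κ0, 0; 0, κ0⁻¹])⁻¹ * (Φ q (q * z) * A z))) →
      TendstoLocallyUniformly (fun (q : ℂ) (z : ℂ) => Φ q z)
        (fun z => t⁻¹ • ((!![κ0, 0; 0, κ0⁻¹])⁻¹ * H⁻¹ * A z)) (𝓝[≠] (0 : ℂ)) ∧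
      TendstoLocallyUniformly (fun (q : ℂ) (z : ℂ) => Φ q (q * z))
        (fun _ => H⁻¹) (𝓝[≠] (0 : ℂ))) := by
  let : NormedRing (Matrix (Fin 2) (Fin 2) ℂ) := Matrix.linftyOpNormedRing
  let : NormedAlgebra ℂ (Matrix (Fin 2) (Fin 2) ℂ) := Matrix.linftyOpNormedAlgebra
  have hdet : IsUnit H.det := (Matrix.isUnit_iff_isUnit_det H).mp hH
  have hHi : H * H⁻¹ = 1 := Matrix.mul_nonsing_inv H hdet
  have hiH : H⁻¹ * H = 1 := Matrix.nonsing_inv_mul H hdet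
  have hKinv : (!![κ0, 0; 0, κ0⁻¹] : Matrix (Fin 2) (Fin 2) ℂ)⁻¹ = !![κ0⁻¹, 0; 0, κ0] := by
    refine Matrix.inv_eq_left_inv ?_
    ext i j; fin_cases i <;> fin_cases j <;> simp [hκ0]
  rw [hKinv]
  set L : Matrix (Fin 2) (Fin 2) ℂ := !![κ0⁻¹, 0; 0, κ0] with hL
  set B : ℂ → Matrix (Fin 2) (Fin 2) ℂ := fun z => t⁻¹ • (H⁻¹ * A z * H) with hBdef
  have hB0 : B 0 = !![κ0, 0; 0, κ0⁻¹] := by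
    have hdiag : (!![κ0 * t, 0; 0, κ0⁻¹ * t] : Matrix (Fin 2) (Fin 2) ℂ)
        = t • !![κ0, 0; 0, κ0⁻¹] := by
      ext i j; fin_cases i <;> fin_cases j <;> simp [mul_comm]
    have : H⁻¹ * A 0 * H = t • !![κ0, 0; 0, κ0⁻¹] := by
      rw [hA, hA0, hdiag]
      simp only [zero_smul, add_zero, ne_eq, OfNat.ofNat_ne_zero, not_false_eq_true, zero_pow]
      rw [mul_assoc, mul_assoc (H * _), hiH, mul_one, ← mul_assoc, hiH, one_mul]
    rw [hBdef]
    beta_reduce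
    rw [this, inv_smul_smul₀ ht]
  have hLB1 : L * B 0 = 1 := by
    rw [hB0, hL]
    ext i j; fin_cases i <;> fin_cases j <;> simp [hκ0]
  have hBd : Differentiable ℂ B := by
    have hAd : Differentiable ℂ A := by
      rw [funext hA]; fun_prop
    exact ((hAd.const_mul H⁻¹).mul_const H).const_smul t⁻¹
  have hκ : 0 < ‖κ0‖ := norm_pos_iff.mpr hκ0
  have hR0pos : 0 < R0 := by rw [hR0]; positivity
  have hρ : 0 < R0⁻¹ := inv_pos.mpr hR0pos
  have hR01 : R0 ≤ 1 := by
    rw [hR0, min_le_iff]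
    rcases le_total ‖κ0‖ 1 with h | h
    · exact Or.inl (pow_le_one₀ hκ.le h)
    · exact Or.inr (pow_le_one₀ (by positivity) (inv_le_one_of_one_le₀ h))
  have hLB : ‖L‖ * ‖B 0‖ ≤ R0⁻¹ := by
    rw [hB0, hL]
    have hs : max ‖κ0‖ ‖κ0⁻¹‖ * max ‖κ0‖ ‖κ0⁻¹‖ ≤ R0⁻¹ := by
      rw [← sq, norm_inv]
      rcases le_total ‖κ0‖ ‖κ0‖⁻¹ with h | h
      · rw [max_eq_right h, inv_pow]
        exact inv_anti₀ hR0pos (hR0 ▸ min_le_left _ _)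
      · rw [max_eq_left h, ← inv_inv (‖κ0‖ ^ 2), ← inv_pow]
        exact inv_anti₀ hR0pos (hR0 ▸ min_le_right _ _)
    refine (mul_le_mul ?_ ?_ (norm_nonneg _) ((norm_nonneg _).trans (le_max_left _ _))).trans hs
    · exact norm_diagonal_fin_two_le (le_max_right _ _) (le_max_left _ _)
    · exact norm_diagonal_fin_two_le (le_max_left _ _) (le_max_right _ _)
  have hlt : ∀ q : ℂ, ‖q‖ < R0 → ‖q‖ < 1 ∧ R0⁻¹ * ‖q‖ < 1 := fun q hq =>
    ⟨hq.trans_le hR01, by rwa [inv_mul_lt_iff₀ hR0pos, mul_one]⟩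
  have hconj : ∀ (q : ℂ) (Φ : ℂ → Matrix (Fin 2) (Fin 2) ℂ),
      ((∀ i j : Fin 2, Differentiable ℂ fun z => Φ z i j) ∧ Φ 0 = H⁻¹ ∧
        ∀ z : ℂ, Φ z = t⁻¹ • (L * (Φ (q * z) * A z))) →
      Differentiable ℂ (fun z => Φ z * H) ∧ Φ 0 * H = 1 ∧
        ∀ z, Φ z * H = L * (Φ (q * z) * H) * B z := by
    rintro q Φ ⟨hd, h0, h⟩
    refine ⟨(differentiable_matrix_iff.mpr hd).mul_const H, by rw [h0, hiH], fun z => ?_⟩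
    conv_lhs => rw [h z]
    simp only [hBdef, Matrix.mul_smul, Matrix.smul_mul, mul_assoc]
    rw [← mul_assoc H H⁻¹, hHi, one_mul]
  refine ⟨fun q _ hq => ?_, fun Φ hΦ => ?_⟩
  · obtain ⟨hq1, hρq⟩ := hlt q hq
    obtain ⟨Ψ, hd, h0, h⟩ := exists_differentiable_eq_mul_comp_mul hρ hBd hLB hLB1 hq1 hρq
    refine ⟨fun z => Ψ z * H⁻¹, ⟨differentiable_matrix_iff.mp (hd.mul_const H⁻¹), by simp [h0],
      fun z => ?_⟩, fun Φ hΦ => ?_⟩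
    · beta_reduce
      conv_lhs => rw [h z]
      simp only [hBdef, Matrix.mul_smul, Matrix.smul_mul, mul_assoc, hHi, mul_one]
    · obtain ⟨hd', h0', h'⟩ := hconj q Φ hΦ
      have heq := eq_of_eq_mul_comp_mul hρ hBd hLB hq1 hρq hd' hd (h0'.trans h0.symm) h' h
      funext z
      rw [← congrFun heq z, mul_assoc, hHi, mul_one]
  · have hev : ∀ᶠ q in 𝓝[≠] (0 : ℂ), Differentiable ℂ (fun z => Φ q z * H) ∧ Φ q 0 * H = 1 ∧
        ∀ z, Φ q z * H = L * (Φ q (q * z) * H) * B z := by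
      have hball : ∀ᶠ q in 𝓝[≠] (0 : ℂ), ‖q‖ < R0 :=
        nhdsWithin_le_nhds (continuous_norm.continuousAt.eventually_lt_const (by simpa))
      filter_upwards [hball, self_mem_nhdsWithin] with q hq hq0
      exact hconj q _ (hΦ q (norm_pos_iff.mpr hq0) hq)
    have key := tendstoLocallyUniformly_of_eq_mul_comp_mul (Ψ := fun q z => Φ q z * H)
      hρ hBd hLB hLB1 hev H⁻¹
    simp only [mul_assoc, hHi, mul_one, hBdef, Matrix.mul_smul, Matrix.smul_mul] at key
    simp only [mul_assoc]
    exact key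
end

section
/- The identity T12 + T13 + T14 + T23 + T24 + T34 = 0 holds, and, assuming the denominators of the a_ij are nonzero, also a12 T12 + a13 T13 + a14 T14 + a23 T23 + a24 T24 + a34 T34 = 0. Consequently, if T12 T34 ≠ 0, the point N_* = (T12, T13, T14, T23, T24, T34) satisfies all four equations defining the curve at infinity of the limiting Segre surface: Σ N_ij = 0, Σ a_ij N_ij = 0, N13 N24 = b1 N12 N34, and N14 N23 = b2 N12 N34. -/
/-- The six coefficients sum to zero. -/
theorem sum_segre_coefficients_eq_zero {K : Type*} [Field K] (κ0 κt κ1 κi t : K)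
    (hκ0 : κ0 ≠ 0) (hκt : κt ≠ 0) (hκ1 : κ1 ≠ 0) :
    (κt ^ 2 - 1) * (κ1 ^ 2 - 1) * (κ0 * t - κi) * (κ0⁻¹ * t - κi)
    + -((κt * κ1⁻¹ * t - 1) * (κt⁻¹ * κ1 * t - 1) * (κ0 * κt * κ1 - κi) * (κ0⁻¹ * κt * κ1 - κi))
    + (κt * κ1 * t - 1) * (κt⁻¹ * κ1⁻¹ * t - 1) * (κ0 * κ1 * κi - κt) * (κ0⁻¹ * κ1 * κi - κt)
    + (κt * κ1 * t - 1) * (κt⁻¹ * κ1⁻¹ * t - 1) * (κ0 * κt * κi - κ1) * (κ0⁻¹ * κt * κi - κ1)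
    + -((κt * κ1⁻¹ * t - 1) * (κt⁻¹ * κ1 * t - 1) * (κ0 * κt * κ1 * κi - 1) *
        (κ0⁻¹ * κt * κ1 * κi - 1))
    + (κt ^ 2 - 1) * (κ1 ^ 2 - 1) * (κ0 * κi * t - 1) * (κ0⁻¹ * κi * t - 1) = 0 := by
  field_simp
  ring

/-- The weight times a product `(k x - y)(k⁻¹ x - y)` is, up to a factor depending only on `k`,
the same product at `k = 1`. -/
theorem weight_mul_coefficient {K : Type*} [Field K] {k a T : K} (c x y : K) (hk : k ≠ 0)
    (h : (k * x - y) * (k * y - x) ≠ 0)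
    (ha : a = (k - 1) ^ 2 * (x - y) ^ 2 / ((k * x - y) * (k * y - x)))
    (hT : T = c * (k * x - y) * (k⁻¹ * x - y)) :
    a * T = -((k - 1) ^ 2 / k) * (c * (x - y) * (x - y)) := by
  have e : T = -(c / k) * ((k * x - y) * (k * y - x)) := by
    rw [hT]
    field_simp
    ring
  rw [ha, e, mul_left_comm, div_mul_cancel₀ _ h]
  ring


theorem stmt_11 (κ0 κt κ1 κi t : ℂ)
    (hκ0 : κ0 ≠ 0) (hκt : κt ≠ 0) (hκ1 : κ1 ≠ 0) (hκi : κi ≠ 0) (ht : t ≠ 0)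
    (T12 T34 T13 T24 T14 T23 : ℂ)
    (hT12 : T12 = (κt ^ 2 - 1) * (κ1 ^ 2 - 1) * (κ0 * t - κi) * (κ0⁻¹ * t - κi))
    (hT34 : T34 = (κt ^ 2 - 1) * (κ1 ^ 2 - 1) * (κ0 * κi * t - 1) * (κ0⁻¹ * κi * t - 1))
    (hT13 : T13 = -((κt * κ1⁻¹ * t - 1) * (κt⁻¹ * κ1 * t - 1) * (κ0 * κt * κ1 - κi) * (κ0⁻¹ * κt * κ1 - κi)))
    (hT24 : T24 = -((κt * κ1⁻¹ * t - 1) * (κt⁻¹ * κ1 * t - 1) * (κ0 * κt * κ1 * κi - 1) * (κ0⁻¹ * κt * κ1 * κi - 1)))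
    (hT14 : T14 = (κt * κ1 * t - 1) * (κt⁻¹ * κ1⁻¹ * t - 1) * (κ0 * κ1 * κi - κt) * (κ0⁻¹ * κ1 * κi - κt))
    (hT23 : T23 = (κt * κ1 * t - 1) * (κt⁻¹ * κ1⁻¹ * t - 1) * (κ0 * κt * κi - κ1) * (κ0⁻¹ * κt * κi - κ1))
    (hd12 : (κ0 * t - κi) * (κ0 * κi - t) ≠ 0)
    (hd34 : (κ0 * κi * t - 1) * (κ0 - κi * t) ≠ 0)
    (hd13 : (κ0 * κt * κ1 - κi) * (κ0 * κi - κt * κ1) ≠ 0)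
    (hd24 : (κ0 * κt * κ1 * κi - 1) * (κ0 - κt * κ1 * κi) ≠ 0)
    (hd14 : (κ0 * κ1 * κi - κt) * (κ0 * κt - κ1 * κi) ≠ 0)
    (hd23 : (κ0 * κt * κi - κ1) * (κ0 * κ1 - κt * κi) ≠ 0)
    (a12 a34 a13 a24 a14 a23 b1 b2 : ℂ)
    (ha12 : a12 = (κ0 - 1) ^ 2 * (t - κi) ^ 2 / ((κ0 * t - κi) * (κ0 * κi - t)))
    (ha34 : a34 = (κ0 - 1) ^ 2 * (κi * t - 1) ^ 2 / ((κ0 * κi * t - 1) * (κ0 - κi * t)))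
    (ha13 : a13 = (κ0 - 1) ^ 2 * (κi - κt * κ1) ^ 2 / ((κ0 * κt * κ1 - κi) * (κ0 * κi - κt * κ1)))
    (ha24 : a24 = (κ0 - 1) ^ 2 * (κt * κ1 * κi - 1) ^ 2 / ((κ0 * κt * κ1 * κi - 1) * (κ0 - κt * κ1 * κi)))
    (ha14 : a14 = (κ0 - 1) ^ 2 * (κt - κ1 * κi) ^ 2 / ((κ0 * κ1 * κi - κt) * (κ0 * κt - κ1 * κi)))
    (ha23 : a23 = (κ0 - 1) ^ 2 * (κ1 - κt * κi) ^ 2 / ((κ0 * κt * κi - κ1) * (κ0 * κ1 - κt * κi)))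
    (hb1 : b1 = T13 * T24 / (T12 * T34))
    (hb2 : b2 = T14 * T23 / (T12 * T34)) :
    T12 + T13 + T14 + T23 + T24 + T34 = 0 ∧
    a12 * T12 + a13 * T13 + a14 * T14 + a23 * T23 + a24 * T24 + a34 * T34 = 0 ∧
    (T12 * T34 ≠ 0 →
      T13 * T24 = b1 * (T12 * T34) ∧ T14 * T23 = b2 * (T12 * T34)) := by
  refine ⟨?_, ?_, fun h => ⟨?_, ?_⟩⟩
  · subst hT12 hT34 hT13 hT24 hT14 hT23
    exact sum_segre_coefficients_eq_zero κ0 κt κ1 κi t hκ0 hκt hκ1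
  · have h12 := weight_mul_coefficient (a := a12) (T := T12)
      ((κt ^ 2 - 1) * (κ1 ^ 2 - 1)) t κi hκ0 hd12 ha12 hT12
    have h34 := weight_mul_coefficient (a := a34) (T := T34)
      ((κt ^ 2 - 1) * (κ1 ^ 2 - 1)) (κi * t) 1 hκ0
      (by convert hd34 using 1; ring) (by rw [ha34]; ring) (by rw [hT34]; ring)
    have h13 := weight_mul_coefficient (a := a13) (T := T13)
      (-((κt * κ1⁻¹ * t - 1) * (κt⁻¹ * κ1 * t - 1))) (κt * κ1) κi hκ0
      (by convert hd13 using 1; ring) (by rw [ha13]; ring) (by rw [hT13]; ring)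
    have h24 := weight_mul_coefficient (a := a24) (T := T24)
      (-((κt * κ1⁻¹ * t - 1) * (κt⁻¹ * κ1 * t - 1))) (κt * κ1 * κi) 1 hκ0
      (by convert hd24 using 1; ring) (by rw [ha24]; ring) (by rw [hT24]; ring)
    have h14 := weight_mul_coefficient (a := a14) (T := T14)
      ((κt * κ1 * t - 1) * (κt⁻¹ * κ1⁻¹ * t - 1)) (κ1 * κi) κt hκ0
      (by convert hd14 using 1; ring) (by rw [ha14]; ring) (by rw [hT14]; ring)
    have h23 := weight_mul_coefficient (a := a23) (T := T23)
      ((κt * κ1 * t - 1) * (κt⁻¹ * κ1⁻¹ * t - 1)) (κt * κi) κ1 hκ0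
      (by convert hd23 using 1; ring) (by rw [ha23]; ring) (by rw [hT23]; ring)
    have hsum := sum_segre_coefficients_eq_zero 1 κt κ1 κi t one_ne_zero hκt hκ1
    rw [inv_one] at hsum
    rw [h12, h34, h13, h24, h14, h23]
    linear_combination -((κ0 - 1) ^ 2 / κ0) * hsum
  · rw [hb1, div_mul_cancel₀ _ h]
  · rw [hb2, div_mul_cancel₀ _ h]
end

section
/- Define u1 = 1/(κ0 − 1)^2, u2 = κ0/(κ0 − 1)^4, u3 = −(κ∞/κ0)(t κt − κ1)(t κ1 − κt)/(T13 T24), u4 = (κ∞/κ0)(t − κt κ1)(t κt κ1 − 1)/(T14 T23). Then the six identities u1 + u2 a12 − u3 b1 T34 − u4 b2 T34 = 0, u1 + u2 a13 + u3 T24 = 0, u1 + u2 a14 + u4 T23 = 0, u1 + u2 a23 + u4 T14 = 0, u1 + u2 a24 + u3 T13 = 0, and u1 + u2 a34 − u3 b1 T12 − u4 b2 T12 = 0 hold; that is, the vector (u1, u2, u3, u4) annihilates the 4×6 Jacobian matrix of the defining equations of the curve at infinity, evaluated at the point N_* = (T12, T13, T14, T23, T24, T34). -/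
lemma mul_div_mul_div_cancel {K : Type*} [Field K] {a : K} (ha : a ≠ 0) (c d e : K) :
    c * a / (a * d / e) = c * e / d := by
  rw [div_div_eq_mul_div, mul_right_comm, mul_comm a d, mul_div_mul_right _ _ ha]

theorem stmt_12 (κ0 κt κ1 κi t : ℂ)
    (hκ0 : κ0 ≠ 0) (hκt : κt ≠ 0) (hκ1 : κ1 ≠ 0) (hκi : κi ≠ 0) (ht : t ≠ 0)
    (hκ02 : κ0 ^ 2 ≠ 1) (hκt2 : κt ^ 2 ≠ 1) (hκ12 : κ1 ^ 2 ≠ 1) (hκi2 : κi ^ 2 ≠ 1)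
    (htt1 : t ≠ κt * κ1) (htt2 : t ≠ (κt * κ1)⁻¹)
    (htt3 : t ≠ κt * κ1⁻¹) (htt4 : t ≠ (κt * κ1⁻¹)⁻¹)
    (hns : ∀ e0 et e1 ei : ℤ, |e0| = 1 → |et| = 1 → |e1| = 1 → |ei| = 1 →
      κ0 ^ e0 * κt ^ et * κ1 ^ e1 * κi ^ ei ≠ 1)
    (hns' : ∀ e0 ei : ℤ, |e0| = 1 → |ei| = 1 → κ0 ^ e0 * κi ^ ei ≠ t)
    (T12 T34 T13 T24 T14 T23 : ℂ)
    (hT12 : T12 = (κt ^ 2 - 1) * (κ1 ^ 2 - 1) * (κ0 * t - κi) * (κ0⁻¹ * t - κi))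
    (hT34 : T34 = (κt ^ 2 - 1) * (κ1 ^ 2 - 1) * (κ0 * κi * t - 1) * (κ0⁻¹ * κi * t - 1))
    (hT13 : T13 = -((κt * κ1⁻¹ * t - 1) * (κt⁻¹ * κ1 * t - 1) * (κ0 * κt * κ1 - κi) * (κ0⁻¹ * κt * κ1 - κi)))
    (hT24 : T24 = -((κt * κ1⁻¹ * t - 1) * (κt⁻¹ * κ1 * t - 1) * (κ0 * κt * κ1 * κi - 1) * (κ0⁻¹ * κt * κ1 * κi - 1)))
    (hT14 : T14 = (κt * κ1 * t - 1) * (κt⁻¹ * κ1⁻¹ * t - 1) * (κ0 * κ1 * κi - κt) * (κ0⁻¹ * κ1 * κi - κt))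
    (hT23 : T23 = (κt * κ1 * t - 1) * (κt⁻¹ * κ1⁻¹ * t - 1) * (κ0 * κt * κi - κ1) * (κ0⁻¹ * κt * κi - κ1))
    (a12 a34 a13 a24 a14 a23 b1 b2 u1 u2 u3 u4 : ℂ)
    (ha12 : a12 = (κ0 - 1) ^ 2 * (t - κi) ^ 2 / ((κ0 * t - κi) * (κ0 * κi - t)))
    (ha34 : a34 = (κ0 - 1) ^ 2 * (κi * t - 1) ^ 2 / ((κ0 * κi * t - 1) * (κ0 - κi * t)))
    (ha13 : a13 = (κ0 - 1) ^ 2 * (κi - κt * κ1) ^ 2 / ((κ0 * κt * κ1 - κi) * (κ0 * κi - κt * κ1)))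
    (ha24 : a24 = (κ0 - 1) ^ 2 * (κt * κ1 * κi - 1) ^ 2 / ((κ0 * κt * κ1 * κi - 1) * (κ0 - κt * κ1 * κi)))
    (ha14 : a14 = (κ0 - 1) ^ 2 * (κt - κ1 * κi) ^ 2 / ((κ0 * κ1 * κi - κt) * (κ0 * κt - κ1 * κi)))
    (ha23 : a23 = (κ0 - 1) ^ 2 * (κ1 - κt * κi) ^ 2 / ((κ0 * κt * κi - κ1) * (κ0 * κ1 - κt * κi)))
    (hb1 : b1 = T13 * T24 / (T12 * T34))
    (hb2 : b2 = T14 * T23 / (T12 * T34))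
    (hu1 : u1 = 1 / (κ0 - 1) ^ 2)
    (hu2 : u2 = κ0 / (κ0 - 1) ^ 4)
    (hu3 : u3 = -(κi / κ0 * ((t * κt - κ1) * (t * κ1 - κt)) / (T13 * T24)))
    (hu4 : u4 = κi / κ0 * ((t - κt * κ1) * (t * κt * κ1 - 1)) / (T14 * T23)) :
    u1 + u2 * a12 - u3 * b1 * T34 - u4 * b2 * T34 = 0 ∧
    u1 + u2 * a13 + u3 * T24 = 0 ∧
    u1 + u2 * a14 + u4 * T23 = 0 ∧
    u1 + u2 * a23 + u4 * T14 = 0 ∧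
    u1 + u2 * a24 + u3 * T13 = 0 ∧
    u1 + u2 * a34 - u3 * b1 * T12 - u4 * b2 * T12 = 0 := by
  have hk : κ0 - 1 ≠ 0 := fun h => hκ02 (by rw [sub_eq_zero.mp h, one_pow])
  have hct : κt ^ 2 - 1 ≠ 0 := sub_ne_zero.mpr hκt2
  have hc1 : κ1 ^ 2 - 1 ≠ 0 := sub_ne_zero.mpr hκ12
  have hf1 : t - κt * κ1 ≠ 0 := sub_ne_zero.mpr htt1
  have hf2 : t * κt * κ1 - 1 ≠ 0 := by
    contrapose! htt2; field_simp; linear_combination htt2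
  have hf3 : t * κ1 - κt ≠ 0 := by
    contrapose! htt3; field_simp; linear_combination htt3
  have hf4 : t * κt - κ1 ≠ 0 := by
    contrapose! htt4; field_simp; linear_combination htt4
  have h12 : κ0 * t - κi ≠ 0 := by
    have h := hns' (-1) 1 (by norm_num) (by norm_num)
    contrapose! h
    simp only [zpow_one, zpow_neg]
    field_simp
    linear_combination -h
  have h12' : κ0 * κi - t ≠ 0 := by
    have h := hns' 1 1 (by norm_num) (by norm_num)
    contrapose! h
    simp only [zpow_one]
    field_simp
    linear_combination h
  have h34 : κ0 * κi * t - 1 ≠ 0 := by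
    have h := hns' (-1) (-1) (by norm_num) (by norm_num)
    contrapose! h
    simp only [zpow_one, zpow_neg]
    field_simp
    linear_combination -h
  have h34' : κ0 - κi * t ≠ 0 := by
    have h := hns' 1 (-1) (by norm_num) (by norm_num)
    contrapose! h
    simp only [zpow_one, zpow_neg]
    field_simp
    linear_combination h
  have h13 : κ0 * κt * κ1 - κi ≠ 0 := by
    have h := hns 1 1 1 (-1) (by norm_num) (by norm_num) (by norm_num) (by norm_num)
    contrapose! h
    simp only [zpow_one, zpow_neg]
    field_simp
    linear_combination h
  have h13' : κ0 * κi - κt * κ1 ≠ 0 := by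
    have h := hns 1 (-1) (-1) 1 (by norm_num) (by norm_num) (by norm_num) (by norm_num)
    contrapose! h
    simp only [zpow_one, zpow_neg]
    field_simp
    linear_combination h
  have h24 : κ0 * κt * κ1 * κi - 1 ≠ 0 := by
    have h := hns 1 1 1 1 (by norm_num) (by norm_num) (by norm_num) (by norm_num)
    contrapose! h
    simp only [zpow_one]
    field_simp
    linear_combination h
  have h24' : κ0 - κt * κ1 * κi ≠ 0 := by
    have h := hns 1 (-1) (-1) (-1) (by norm_num) (by norm_num) (by norm_num) (by norm_num)
    contrapose! h
    simp only [zpow_one, zpow_neg]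
    field_simp
    linear_combination h
  have h14 : κ0 * κ1 * κi - κt ≠ 0 := by
    have h := hns 1 (-1) 1 1 (by norm_num) (by norm_num) (by norm_num) (by norm_num)
    contrapose! h
    simp only [zpow_one, zpow_neg]
    field_simp
    linear_combination h
  have h14' : κ0 * κt - κ1 * κi ≠ 0 := by
    have h := hns 1 1 (-1) (-1) (by norm_num) (by norm_num) (by norm_num) (by norm_num)
    contrapose! h
    simp only [zpow_one, zpow_neg]
    field_simp
    linear_combination h
  have h23 : κ0 * κt * κi - κ1 ≠ 0 := by
    have h := hns 1 1 (-1) 1 (by norm_num) (by norm_num) (by norm_num) (by norm_num)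
    contrapose! h
    simp only [zpow_one, zpow_neg]
    field_simp
    linear_combination h
  have h23' : κ0 * κ1 - κt * κi ≠ 0 := by
    have h := hns 1 (-1) 1 (-1) (by norm_num) (by norm_num) (by norm_num) (by norm_num)
    contrapose! h
    simp only [zpow_one, zpow_neg]
    field_simp
    linear_combination h
  have hs12 : u1 + u2 * a12 = t * κi / ((κ0 * t - κi) * (κ0 * κi - t)) := by
    rw [hu1, hu2, ha12]
    field_simp
    ring
  have hF12 : T12 =
      -((κt ^ 2 - 1) * (κ1 ^ 2 - 1) * ((κ0 * t - κi) * (κ0 * κi - t)) / κ0) := by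
    rw [hT12]
    field_simp
    ring
  have hN12 : T12 ≠ 0 := by
    rw [hF12]
    simp [*]
  have hs34 : u1 + u2 * a34 = κi * t / ((κ0 * κi * t - 1) * (κ0 - κi * t)) := by
    rw [hu1, hu2, ha34]
    field_simp
    ring
  have hF34 : T34 =
      -((κt ^ 2 - 1) * (κ1 ^ 2 - 1) * ((κ0 * κi * t - 1) * (κ0 - κi * t)) / κ0) := by
    rw [hT34]
    field_simp
    ring
  have hN34 : T34 ≠ 0 := by
    rw [hF34]
    simp [*]
  have hs13 : u1 + u2 * a13 = κt * κ1 * κi / ((κ0 * κt * κ1 - κi) * (κ0 * κi - κt * κ1)) := by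
    rw [hu1, hu2, ha13]
    field_simp
    ring
  have hF13 : T13 =
      ((t * κt - κ1) * (t * κ1 - κt)) * ((κ0 * κt * κ1 - κi) * (κ0 * κi - κt * κ1)) / (κ0 * κt * κ1) := by
    rw [hT13]
    field_simp
    ring
  have hN13 : T13 ≠ 0 := by
    rw [hF13]
    simp [*]
  have hs24 : u1 + u2 * a24 = κt * κ1 * κi / ((κ0 * κt * κ1 * κi - 1) * (κ0 - κt * κ1 * κi)) := by
    rw [hu1, hu2, ha24]
    field_simp
    ring
  have hF24 : T24 =
      ((t * κt - κ1) * (t * κ1 - κt)) * ((κ0 * κt * κ1 * κi - 1) * (κ0 - κt * κ1 * κi)) / (κ0 * κt * κ1) := by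
    rw [hT24]
    field_simp
    ring
  have hN24 : T24 ≠ 0 := by
    rw [hF24]
    simp [*]
  have hs14 : u1 + u2 * a14 = κ1 * κi * κt / ((κ0 * κ1 * κi - κt) * (κ0 * κt - κ1 * κi)) := by
    rw [hu1, hu2, ha14]
    field_simp
    ring
  have hF14 : T14 =
      -(((t - κt * κ1) * (t * κt * κ1 - 1)) * ((κ0 * κ1 * κi - κt) * (κ0 * κt - κ1 * κi)) / (κ0 * κt * κ1)) := by
    rw [hT14]
    field_simp
    ring
  have hN14 : T14 ≠ 0 := by
    rw [hF14]
    simp [*]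
  have hs23 : u1 + u2 * a23 = κt * κi * κ1 / ((κ0 * κt * κi - κ1) * (κ0 * κ1 - κt * κi)) := by
    rw [hu1, hu2, ha23]
    field_simp
    ring
  have hF23 : T23 =
      -(((t - κt * κ1) * (t * κt * κ1 - 1)) * ((κ0 * κt * κi - κ1) * (κ0 * κ1 - κt * κi)) / (κ0 * κt * κ1)) := by
    rw [hT23]
    field_simp
    ring
  have hN23 : T23 ≠ 0 := by
    rw [hF23]
    simp [*]
  have hsum : u3 * (T13 * T24) + u4 * (T14 * T23) =
      -(κi / κ0 * (t * (κt ^ 2 - 1) * (κ1 ^ 2 - 1))) := by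
    rw [hu3, hu4]
    field_simp
    ring
  refine ⟨?_, ?_, ?_, ?_, ?_, ?_⟩
  · have h : u3 * b1 * T34 + u4 * b2 * T34 =
        (u3 * (T13 * T24) + u4 * (T14 * T23)) / T12 := by
      rw [hb1, hb2]
      field_simp
    rw [sub_sub, h, hsum, hs12, hF12]
    field_simp
    ring
  · have h : u3 * T24 = -(κi / κ0 * ((t * κt - κ1) * (t * κ1 - κt)) / T13) := by
      rw [hu3]
      field_simp
    rw [h, hs13, hF13, mul_div_mul_div_cancel (mul_ne_zero hf4 hf3)]
    field_simp
    ring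
  · have h : u4 * T23 = κi / κ0 * ((t - κt * κ1) * (t * κt * κ1 - 1)) / T14 := by
      rw [hu4]
      field_simp
    rw [h, hs14, hF14, div_neg, mul_div_mul_div_cancel (mul_ne_zero hf1 hf2)]
    field_simp
    ring
  · have h : u4 * T14 = κi / κ0 * ((t - κt * κ1) * (t * κt * κ1 - 1)) / T23 := by
      rw [hu4]
      field_simp
    rw [h, hs23, hF23, div_neg, mul_div_mul_div_cancel (mul_ne_zero hf1 hf2)]
    field_simp
    ring
  · have h : u3 * T13 = -(κi / κ0 * ((t * κt - κ1) * (t * κ1 - κt)) / T24) := by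
      rw [hu3]
      field_simp
    rw [h, hs24, hF24, mul_div_mul_div_cancel (mul_ne_zero hf4 hf3)]
    field_simp
    ring
  · have h : u3 * b1 * T12 + u4 * b2 * T12 =
        (u3 * (T13 * T24) + u4 * (T14 * T23)) / T34 := by
      rw [hb1, hb2]
      field_simp
    rw [sub_sub, h, hsum, hs34, hF34]
    field_simp
    ring
end

section
/- For every f ∈ ℂ, the six polynomial values N12(f), N13(f), N14(f), N23(f), N24(f), N34(f) satisfy the four equations defining the curve at infinity of the limiting Segre surface: N12(f) + N13(f) + N14(f) + N23(f) + N24(f) + N34(f) = 0; a12 N12(f) + a13 N13(f) + a14 N14(f) + a23 N23(f) + a24 N24(f) + a34 N34(f) = 0 (assuming the denominators of the a_ij are nonzero); N13(f) N24(f) = b1 N12(f) N34(f); and N14(f) N23(f) = b2 N12(f) N34(f) (assuming T12 T34 ≠ 0). -/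
lemma sum_sq_sub_eq_zero {κt κ1 : ℂ} (hκt : κt ≠ 0) (hκ1 : κ1 ≠ 0) (κi t f : ℂ) :
      (κt ^ 2 - 1) * (κ1 ^ 2 - 1) * (t - κi) ^ 2 *
        ((f - κ1) * (f - κ1⁻¹) * (f - t * κt * κi ^ 2) * (f - t * κt⁻¹ * κi ^ 2)) +
      (κt ^ 2 - 1) * (κ1 ^ 2 - 1) * ((κi * t) - 1) ^ 2 *
        ((f - t * κt) * (f - t * κt⁻¹) * (f - κ1 * κi ^ 2) * (f - κ1⁻¹ * κi ^ 2)) -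
      (κt * κ1⁻¹ * t - 1) * (κt⁻¹ * κ1 * t - 1) * ((κt * κ1) - κi) ^ 2 *
        ((f - t * κt⁻¹) * (f - κ1⁻¹) * (f - t * κt * κi ^ 2) * (f - κ1 * κi ^ 2)) -
      (κt * κ1⁻¹ * t - 1) * (κt⁻¹ * κ1 * t - 1) * ((κt * κ1 * κi) - 1) ^ 2 *
        ((f - κ1) * (f - t * κt) * (f - t * κt⁻¹ * κi ^ 2) * (f - κ1⁻¹ * κi ^ 2)) +
      (κt * κ1 * t - 1) * (κt⁻¹ * κ1⁻¹ * t - 1) * ((κ1 * κi) - κt) ^ 2 *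
        ((f - κ1) * (f - t * κt⁻¹) * (f - t * κt * κi ^ 2) * (f - κ1⁻¹ * κi ^ 2)) +
      (κt * κ1 * t - 1) * (κt⁻¹ * κ1⁻¹ * t - 1) * ((κt * κi) - κ1) ^ 2 *
        ((f - t * κt) * (f - κ1⁻¹) * (f - t * κt⁻¹ * κi ^ 2) * (f - κ1 * κi ^ 2)) = 0 := by
  field_simp
  ring

lemma sum_mul_eq_zero {κt κ1 : ℂ} (hκt : κt ≠ 0) (hκ1 : κ1 ≠ 0) (κi t f : ℂ) :
      (κt ^ 2 - 1) * (κ1 ^ 2 - 1) * (t * κi) *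
        ((f - κ1) * (f - κ1⁻¹) * (f - t * κt * κi ^ 2) * (f - t * κt⁻¹ * κi ^ 2)) +
      (κt ^ 2 - 1) * (κ1 ^ 2 - 1) * ((κi * t) * 1) *
        ((f - t * κt) * (f - t * κt⁻¹) * (f - κ1 * κi ^ 2) * (f - κ1⁻¹ * κi ^ 2)) -
      (κt * κ1⁻¹ * t - 1) * (κt⁻¹ * κ1 * t - 1) * ((κt * κ1) * κi) *
        ((f - t * κt⁻¹) * (f - κ1⁻¹) * (f - t * κt * κi ^ 2) * (f - κ1 * κi ^ 2)) -
      (κt * κ1⁻¹ * t - 1) * (κt⁻¹ * κ1 * t - 1) * ((κt * κ1 * κi) * 1) *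
        ((f - κ1) * (f - t * κt) * (f - t * κt⁻¹ * κi ^ 2) * (f - κ1⁻¹ * κi ^ 2)) +
      (κt * κ1 * t - 1) * (κt⁻¹ * κ1⁻¹ * t - 1) * ((κ1 * κi) * κt) *
        ((f - κ1) * (f - t * κt⁻¹) * (f - t * κt * κi ^ 2) * (f - κ1⁻¹ * κi ^ 2)) +
      (κt * κ1 * t - 1) * (κt⁻¹ * κ1⁻¹ * t - 1) * ((κt * κi) * κ1) *
        ((f - t * κt) * (f - κ1⁻¹) * (f - t * κt⁻¹ * κi ^ 2) * (f - κ1 * κi ^ 2)) = 0 := by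
  field_simp
  ring


theorem stmt_13 (κ0 κt κ1 κi t : ℂ)
    (hκ0 : κ0 ≠ 0) (hκt : κt ≠ 0) (hκ1 : κ1 ≠ 0) (hκi : κi ≠ 0) (ht : t ≠ 0)
    (T12 T34 T13 T24 T14 T23 : ℂ)
    (hT12 : T12 = (κt ^ 2 - 1) * (κ1 ^ 2 - 1) * (κ0 * t - κi) * (κ0⁻¹ * t - κi))
    (hT34 : T34 = (κt ^ 2 - 1) * (κ1 ^ 2 - 1) * (κ0 * κi * t - 1) * (κ0⁻¹ * κi * t - 1))
    (hT13 : T13 = -((κt * κ1⁻¹ * t - 1) * (κt⁻¹ * κ1 * t - 1) * (κ0 * κt * κ1 - κi) * (κ0⁻¹ * κt * κ1 - κi)))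
    (hT24 : T24 = -((κt * κ1⁻¹ * t - 1) * (κt⁻¹ * κ1 * t - 1) * (κ0 * κt * κ1 * κi - 1) * (κ0⁻¹ * κt * κ1 * κi - 1)))
    (hT14 : T14 = (κt * κ1 * t - 1) * (κt⁻¹ * κ1⁻¹ * t - 1) * (κ0 * κ1 * κi - κt) * (κ0⁻¹ * κ1 * κi - κt))
    (hT23 : T23 = (κt * κ1 * t - 1) * (κt⁻¹ * κ1⁻¹ * t - 1) * (κ0 * κt * κi - κ1) * (κ0⁻¹ * κt * κi - κ1))
    (hd12 : (κ0 * t - κi) * (κ0 * κi - t) ≠ 0)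
    (hd34 : (κ0 * κi * t - 1) * (κ0 - κi * t) ≠ 0)
    (hd13 : (κ0 * κt * κ1 - κi) * (κ0 * κi - κt * κ1) ≠ 0)
    (hd24 : (κ0 * κt * κ1 * κi - 1) * (κ0 - κt * κ1 * κi) ≠ 0)
    (hd14 : (κ0 * κ1 * κi - κt) * (κ0 * κt - κ1 * κi) ≠ 0)
    (hd23 : (κ0 * κt * κi - κ1) * (κ0 * κ1 - κt * κi) ≠ 0)
    (a12 a34 a13 a24 a14 a23 b1 b2 : ℂ)
    (ha12 : a12 = (κ0 - 1) ^ 2 * (t - κi) ^ 2 / ((κ0 * t - κi) * (κ0 * κi - t)))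
    (ha34 : a34 = (κ0 - 1) ^ 2 * (κi * t - 1) ^ 2 / ((κ0 * κi * t - 1) * (κ0 - κi * t)))
    (ha13 : a13 = (κ0 - 1) ^ 2 * (κi - κt * κ1) ^ 2 / ((κ0 * κt * κ1 - κi) * (κ0 * κi - κt * κ1)))
    (ha24 : a24 = (κ0 - 1) ^ 2 * (κt * κ1 * κi - 1) ^ 2 / ((κ0 * κt * κ1 * κi - 1) * (κ0 - κt * κ1 * κi)))
    (ha14 : a14 = (κ0 - 1) ^ 2 * (κt - κ1 * κi) ^ 2 / ((κ0 * κ1 * κi - κt) * (κ0 * κt - κ1 * κi)))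
    (ha23 : a23 = (κ0 - 1) ^ 2 * (κ1 - κt * κi) ^ 2 / ((κ0 * κt * κi - κ1) * (κ0 * κ1 - κt * κi)))
    (hb1 : b1 = T13 * T24 / (T12 * T34))
    (hb2 : b2 = T14 * T23 / (T12 * T34))
    (hT1234 : T12 * T34 ≠ 0)
    (N12 N13 N14 N23 N24 N34 : ℂ → ℂ)
    (hN12 : ∀ f : ℂ, N12 f = T12 * (f - κ1) * (f - κ1⁻¹) * (f - t * κt * κi ^ 2) * (f - t * κt⁻¹ * κi ^ 2))
    (hN13 : ∀ f : ℂ, N13 f = T13 * (f - t * κt⁻¹) * (f - κ1⁻¹) * (f - t * κt * κi ^ 2) * (f - κ1 * κi ^ 2))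
    (hN14 : ∀ f : ℂ, N14 f = T14 * (f - κ1) * (f - t * κt⁻¹) * (f - t * κt * κi ^ 2) * (f - κ1⁻¹ * κi ^ 2))
    (hN23 : ∀ f : ℂ, N23 f = T23 * (f - t * κt) * (f - κ1⁻¹) * (f - t * κt⁻¹ * κi ^ 2) * (f - κ1 * κi ^ 2))
    (hN24 : ∀ f : ℂ, N24 f = T24 * (f - κ1) * (f - t * κt) * (f - t * κt⁻¹ * κi ^ 2) * (f - κ1⁻¹ * κi ^ 2))
    (hN34 : ∀ f : ℂ, N34 f = T34 * (f - t * κt) * (f - t * κt⁻¹) * (f - κ1 * κi ^ 2) * (f - κ1⁻¹ * κi ^ 2)) :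
    ∀ f : ℂ,
      N12 f + N13 f + N14 f + N23 f + N24 f + N34 f = 0 ∧
      a12 * N12 f + a13 * N13 f + a14 * N14 f + a23 * N23 f + a24 * N24 f + a34 * N34 f = 0 ∧
      N13 f * N24 f = b1 * (N12 f * N34 f) ∧
      N14 f * N23 f = b2 * (N12 f * N34 f) := by
  intro f
  have hfac (x y : ℂ) : (κ0 * x - y) * (κ0⁻¹ * x - y) =
      (x - y) ^ 2 - (κ0 - 1) ^ 2 / κ0 * (x * y) := by
    field_simp
    ring
  have hcancel (x y : ℂ) (h : (κ0 * x - y) * (κ0 * y - x) ≠ 0) :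
      (κ0 - 1) ^ 2 * (x - y) ^ 2 / ((κ0 * x - y) * (κ0 * y - x)) *
        ((κ0 * x - y) * (κ0⁻¹ * x - y)) = -((κ0 - 1) ^ 2 / κ0) * (x - y) ^ 2 := by
    rw [show κ0⁻¹ * x - y = -(κ0 * y - x) / κ0 by field_simp; ring]
    rw [div_mul_eq_mul_div, div_eq_iff h]
    ring
  have hsq := sum_sq_sub_eq_zero hκt hκ1 κi t f
  have hprod := sum_mul_eq_zero hκt hκ1 κi t f
  have h12 := hcancel t κi hd12
  have h34 := hcancel (κi * t) 1 (by convert hd34 using 1; ring)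
  have h13 := hcancel (κt * κ1) κi (by convert hd13 using 1; ring)
  have h24 := hcancel (κt * κ1 * κi) 1 (by convert hd24 using 1; ring)
  have h14 := hcancel (κ1 * κi) κt (by convert hd14 using 1; ring)
  have h23 := hcancel (κt * κi) κ1 (by convert hd23 using 1; ring)
  have e12 := hfac t κi
  have e34 := hfac (κi * t) 1
  have e13 := hfac (κt * κ1) κi
  have e24 := hfac (κt * κ1 * κi) 1
  have e14 := hfac (κ1 * κi) κt
  have e23 := hfac (κt * κi) κ1
  rw [show (κ0 - 1) ^ 2 * (t - κi) ^ 2 / ((κ0 * t - κi) * (κ0 * κi - t)) = a12 from ha12.symm] at h12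
  rw [show (κ0 - 1) ^ 2 * (κi * t - 1) ^ 2 / ((κ0 * (κi * t) - 1) * (κ0 * 1 - κi * t)) = a34 by
    rw [ha34]; ring_nf] at h34
  rw [show (κ0 - 1) ^ 2 * (κt * κ1 - κi) ^ 2 /
      ((κ0 * (κt * κ1) - κi) * (κ0 * κi - κt * κ1)) = a13 by rw [ha13]; ring_nf] at h13
  rw [show (κ0 - 1) ^ 2 * (κt * κ1 * κi - 1) ^ 2 /
      ((κ0 * (κt * κ1 * κi) - 1) * (κ0 * 1 - κt * κ1 * κi)) = a24 by rw [ha24]; ring_nf] at h24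
  rw [show (κ0 - 1) ^ 2 * (κ1 * κi - κt) ^ 2 /
      ((κ0 * (κ1 * κi) - κt) * (κ0 * κt - κ1 * κi)) = a14 by rw [ha14]; ring_nf] at h14
  rw [show (κ0 - 1) ^ 2 * (κt * κi - κ1) ^ 2 /
      ((κ0 * (κt * κi) - κ1) * (κ0 * κ1 - κt * κi)) = a23 by rw [ha23]; ring_nf] at h23
  generalize (κ0 - 1) ^ 2 / κ0 = w at *
  have hb1' : b1 * (T12 * T34) = T13 * T24 := by rw [hb1, div_mul_cancel₀ _ hT1234]
  have hb2' : b2 * (T12 * T34) = T14 * T23 := by rw [hb2, div_mul_cancel₀ _ hT1234]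
  rw [hN12, hN13, hN14, hN23, hN24, hN34]
  refine ⟨?_, ?_, ?_, ?_⟩
  · rw [hT12, hT13, hT14, hT23, hT24, hT34]
    linear_combination hsq - w * hprod + 
      (κt ^ 2 - 1) * (κ1 ^ 2 - 1) * ((f - κ1) * (f - κ1⁻¹) * (f - t * κt * κi ^ 2) * (f - t * κt⁻¹ * κi ^ 2)) * e12 +
      (κt ^ 2 - 1) * (κ1 ^ 2 - 1) * ((f - t * κt) * (f - t * κt⁻¹) * (f - κ1 * κi ^ 2) * (f - κ1⁻¹ * κi ^ 2)) * e34 -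
      (κt * κ1⁻¹ * t - 1) * (κt⁻¹ * κ1 * t - 1) * ((f - t * κt⁻¹) * (f - κ1⁻¹) * (f - t * κt * κi ^ 2) * (f - κ1 * κi ^ 2)) * e13 -
      (κt * κ1⁻¹ * t - 1) * (κt⁻¹ * κ1 * t - 1) * ((f - κ1) * (f - t * κt) * (f - t * κt⁻¹ * κi ^ 2) * (f - κ1⁻¹ * κi ^ 2)) * e24 +
      (κt * κ1 * t - 1) * (κt⁻¹ * κ1⁻¹ * t - 1) * ((f - κ1) * (f - t * κt⁻¹) * (f - t * κt * κi ^ 2) * (f - κ1⁻¹ * κi ^ 2)) * e14 +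
      (κt * κ1 * t - 1) * (κt⁻¹ * κ1⁻¹ * t - 1) * ((f - t * κt) * (f - κ1⁻¹) * (f - t * κt⁻¹ * κi ^ 2) * (f - κ1 * κi ^ 2)) * e23
  · rw [hT12, hT13, hT14, hT23, hT24, hT34]
    linear_combination -w * hsq + 
      (κt ^ 2 - 1) * (κ1 ^ 2 - 1) * ((f - κ1) * (f - κ1⁻¹) * (f - t * κt * κi ^ 2) * (f - t * κt⁻¹ * κi ^ 2)) * h12 +
      (κt ^ 2 - 1) * (κ1 ^ 2 - 1) * ((f - t * κt) * (f - t * κt⁻¹) * (f - κ1 * κi ^ 2) * (f - κ1⁻¹ * κi ^ 2)) * h34 -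
      (κt * κ1⁻¹ * t - 1) * (κt⁻¹ * κ1 * t - 1) * ((f - t * κt⁻¹) * (f - κ1⁻¹) * (f - t * κt * κi ^ 2) * (f - κ1 * κi ^ 2)) * h13 -
      (κt * κ1⁻¹ * t - 1) * (κt⁻¹ * κ1 * t - 1) * ((f - κ1) * (f - t * κt) * (f - t * κt⁻¹ * κi ^ 2) * (f - κ1⁻¹ * κi ^ 2)) * h24 +
      (κt * κ1 * t - 1) * (κt⁻¹ * κ1⁻¹ * t - 1) * ((f - κ1) * (f - t * κt⁻¹) * (f - t * κt * κi ^ 2) * (f - κ1⁻¹ * κi ^ 2)) * h14 +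
      (κt * κ1 * t - 1) * (κt⁻¹ * κ1⁻¹ * t - 1) * ((f - t * κt) * (f - κ1⁻¹) * (f - t * κt⁻¹ * κi ^ 2) * (f - κ1 * κi ^ 2)) * h23
  · linear_combination -((f - κ1) * (f - κ1⁻¹) * (f - t * κt * κi ^ 2) * (f - t * κt⁻¹ * κi ^ 2)) *
      ((f - t * κt) * (f - t * κt⁻¹) * (f - κ1 * κi ^ 2) * (f - κ1⁻¹ * κi ^ 2)) * hb1'
  · linear_combination -((f - κ1) * (f - κ1⁻¹) * (f - t * κt * κi ^ 2) * (f - t * κt⁻¹ * κi ^ 2)) *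
      ((f - t * κt) * (f - t * κt⁻¹) * (f - κ1 * κi ^ 2) * (f - κ1⁻¹ * κi ^ 2)) * hb2'
end

section
/- The rational parametrisation of the curve at infinity is projectively injective on ℂ \ {0}: if f1, f2 ∈ ℂ \ {0} and c ∈ ℂ \ {0} are such that N_ij(f1) = c · N_ij(f2) for all six index pairs (i,j) ∈ {(1,2),(1,3),(1,4),(2,3),(2,4),(3,4)}, then f1 = f2. -/
/-- If two of the six products at `u` and `v` are proportional and nonzero, the corresponding
cross ratio of factors forces `u = v` or `u * v = s * x * y`. -/
lemma eq_or_mul_eq_of_proportional {K : Type*} [Field K] {s w x y z u v k : K}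
    (hs : s ≠ 1) (hxy : x ≠ y)
    (hx : (u - w) * (u - x) * (u - s * y) * (u - s * z) =
      k * ((v - w) * (v - x) * (v - s * y) * (v - s * z)))
    (hy : (u - w) * (u - y) * (u - s * x) * (u - s * z) =
      k * ((v - w) * (v - y) * (v - s * x) * (v - s * z)))
    (hk : k ≠ 0) (huw : u - w ≠ 0) (huz : u - s * z ≠ 0)
    (hvw : v - w ≠ 0) (hvz : v - s * z ≠ 0) :
    u = v ∨ u * v = s * x * y := by
  have hne : (u - w) * (u - s * z) * (k * (v - w) * (v - s * z)) ≠ 0 := by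
    simp only [ne_eq, mul_eq_zero, not_or]
    tauto
  have hcross : (u - x) * (u - s * y) * ((v - y) * (v - s * x)) =
      (u - y) * (u - s * x) * ((v - x) * (v - s * y)) := by
    apply mul_left_cancel₀ hne
    linear_combination (k * (v - w) * (v - s * z) * ((v - y) * (v - s * x))) * hx -
      (k * (v - w) * (v - s * z) * ((v - x) * (v - s * y))) * hy
  have hfac : (s - 1) * (x - y) * ((u - v) * (u * v - s * x * y)) = 0 := by
    linear_combination -hcross
  have h : (u - v) * (u * v - s * x * y) = 0 :=
    (mul_eq_zero.mp hfac).resolve_left (mul_ne_zero (sub_ne_zero.mpr hs) (sub_ne_zero.mpr hxy))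
  exact (mul_eq_zero.mp h).imp sub_eq_zero.mp sub_eq_zero.mp

/-- If the six products at `u` and `v` are proportional and `u = a` is a root of three of them,
then `v = u`. -/
lemma eq_of_eq_left_root {K : Type*} [Field K] {s a b c d u v k : K}
    (hs0 : s ≠ 0) (hs : s ≠ 1) (ha : a ≠ 0) (hb : b ≠ 0) (hc : c ≠ 0) (hd : d ≠ 0)
    (hab : a ≠ b) (hac : a ≠ c) (had : a ≠ d) (hbc : b ≠ c) (hbd : b ≠ d) (hcd : c ≠ d)
    (hk : k ≠ 0)
    (h1 : (u - a) * (u - b) * (u - s * c) * (u - s * d) =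
      k * ((v - a) * (v - b) * (v - s * c) * (v - s * d)))
    (h2 : (u - a) * (u - c) * (u - s * b) * (u - s * d) =
      k * ((v - a) * (v - c) * (v - s * b) * (v - s * d)))
    (h3 : (u - a) * (u - d) * (u - s * b) * (u - s * c) =
      k * ((v - a) * (v - d) * (v - s * b) * (v - s * c)))
    (h4 : (u - b) * (u - c) * (u - s * a) * (u - s * d) =
      k * ((v - b) * (v - c) * (v - s * a) * (v - s * d)))
    (h5 : (u - b) * (u - d) * (u - s * a) * (u - s * c) =
      k * ((v - b) * (v - d) * (v - s * a) * (v - s * c)))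
    (h6 : (u - c) * (u - d) * (u - s * a) * (u - s * b) =
      k * ((v - c) * (v - d) * (v - s * a) * (v - s * b)))
    (hu : u = a) : u = v := by
  subst hu
  have hself : ∀ {x : K}, x ≠ 0 → s * x ≠ x := fun hx h => hs (by simpa [hx] using h)
  have hinj : ∀ {x y : K}, x ≠ y → s * x ≠ s * y := fun h h' => h (mul_left_cancel₀ hs0 h')
  have nu := hself ha
  have nb := hself hb
  have nc := hself hc
  have nd := hself hd
  have ibc := hinj hbc
  have ibd := hinj hbd
  have icd := hinj hcd
  by_contra hv
  have hv' : v - u ≠ 0 := sub_ne_zero.mpr (Ne.symm hv)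
  simp only [sub_self, zero_mul, zero_eq_mul, hk, hv', mul_eq_zero, false_or, sub_eq_zero] at h1 h2 h3
  clear hself hinj
  have key : v = s * b ∨ v = s * c ∨ v = s * d := by
    by_contra! hk'
    obtain ⟨kb, kc, _⟩ := hk'
    exact hbc (((h1.resolve_right ‹_›).resolve_right kc).symm.trans
      ((h2.resolve_right ‹_›).resolve_right kb))
  rcases key with rfl | rfl | rfl
  · simp only [sub_self, mul_zero, mul_eq_zero, sub_eq_zero] at h6
    grind
  · simp only [sub_self, mul_zero, mul_eq_zero, sub_eq_zero] at h5
    grind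
  · simp only [sub_self, mul_zero, mul_eq_zero, sub_eq_zero] at h4
    grind

/-- The map sending `u` to the six products of `(u - x) / (u - s * x)` over pairs of four distinct
nonzero points `x`, with denominators cleared, is projectively injective. -/
lemma eq_of_pairwise_products_proportional {K : Type*} [Field K] {s a b c d u v k : K}
    (hs0 : s ≠ 0) (hs : s ≠ 1) (ha : a ≠ 0) (hb : b ≠ 0) (hc : c ≠ 0) (hd : d ≠ 0)
    (hab : a ≠ b) (hac : a ≠ c) (had : a ≠ d) (hbc : b ≠ c) (hbd : b ≠ d) (hcd : c ≠ d)
    (hk : k ≠ 0)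
    (h1 : (u - a) * (u - b) * (u - s * c) * (u - s * d) =
      k * ((v - a) * (v - b) * (v - s * c) * (v - s * d)))
    (h2 : (u - a) * (u - c) * (u - s * b) * (u - s * d) =
      k * ((v - a) * (v - c) * (v - s * b) * (v - s * d)))
    (h3 : (u - a) * (u - d) * (u - s * b) * (u - s * c) =
      k * ((v - a) * (v - d) * (v - s * b) * (v - s * c)))
    (h4 : (u - b) * (u - c) * (u - s * a) * (u - s * d) =
      k * ((v - b) * (v - c) * (v - s * a) * (v - s * d)))
    (h5 : (u - b) * (u - d) * (u - s * a) * (u - s * c) =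
      k * ((v - b) * (v - d) * (v - s * a) * (v - s * c)))
    (h6 : (u - c) * (u - d) * (u - s * a) * (u - s * b) =
      k * ((v - c) * (v - d) * (v - s * a) * (v - s * b))) :
    u = v := by
  have hs' : s⁻¹ ≠ 1 := by simpa using hs
  have hmul : ∀ {x : K}, x ≠ 0 → s * x ≠ 0 := mul_ne_zero hs0
  have hinj : ∀ {x y : K}, x ≠ y → s * x ≠ s * y := fun h h' => h (mul_left_cancel₀ hs0 h')
  by_cases ea : u = a
  · exact eq_of_eq_left_root hs0 hs ha hb hc hd hab hac had hbc hbd hcd hk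
      (by linear_combination h1)
      (by linear_combination h2)
      (by linear_combination h3)
      (by linear_combination h4)
      (by linear_combination h5)
      (by linear_combination h6) ea
  by_cases eb : u = b
  · exact eq_of_eq_left_root hs0 hs hb ha hc hd hab.symm hbc hbd hac had hcd hk
      (by linear_combination h1)
      (by linear_combination h4)
      (by linear_combination h5)
      (by linear_combination h2)
      (by linear_combination h3)
      (by linear_combination h6) eb
  by_cases ec : u = c
  · exact eq_of_eq_left_root hs0 hs hc ha hb hd hac.symm hbc.symm hcd hab had hbd hk
      (by linear_combination h2)
      (by linear_combination h4)
      (by linear_combination h6)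
      (by linear_combination h1)
      (by linear_combination h3)
      (by linear_combination h5) ec
  by_cases ed : u = d
  · exact eq_of_eq_left_root hs0 hs hd ha hb hc had.symm hbd.symm hcd.symm hab hac hbc hk
      (by linear_combination h3)
      (by linear_combination h5)
      (by linear_combination h6)
      (by linear_combination h1)
      (by linear_combination h2)
      (by linear_combination h4) ed
  by_cases ra : u = s * a
  · exact eq_of_eq_left_root (inv_ne_zero hs0) hs' (hmul ha) (hmul hb) (hmul hc) (hmul hd)
      (hinj hab) (hinj hac) (hinj had) (hinj hbc) (hinj hbd) (hinj hcd) hk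
      (by simpa only [inv_mul_cancel_left₀ hs0, mul_comm, mul_left_comm, mul_assoc] using h6)
      (by simpa only [inv_mul_cancel_left₀ hs0, mul_comm, mul_left_comm, mul_assoc] using h5)
      (by simpa only [inv_mul_cancel_left₀ hs0, mul_comm, mul_left_comm, mul_assoc] using h4)
      (by simpa only [inv_mul_cancel_left₀ hs0, mul_comm, mul_left_comm, mul_assoc] using h3)
      (by simpa only [inv_mul_cancel_left₀ hs0, mul_comm, mul_left_comm, mul_assoc] using h2)
      (by simpa only [inv_mul_cancel_left₀ hs0, mul_comm, mul_left_comm, mul_assoc] using h1) ra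
  by_cases rb : u = s * b
  · exact eq_of_eq_left_root (inv_ne_zero hs0) hs' (hmul hb) (hmul ha) (hmul hc) (hmul hd)
      (hinj hab.symm) (hinj hbc) (hinj hbd) (hinj hac) (hinj had) (hinj hcd) hk
      (by simpa only [inv_mul_cancel_left₀ hs0, mul_comm, mul_left_comm, mul_assoc] using h6)
      (by simpa only [inv_mul_cancel_left₀ hs0, mul_comm, mul_left_comm, mul_assoc] using h3)
      (by simpa only [inv_mul_cancel_left₀ hs0, mul_comm, mul_left_comm, mul_assoc] using h2)
      (by simpa only [inv_mul_cancel_left₀ hs0, mul_comm, mul_left_comm, mul_assoc] using h5)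
      (by simpa only [inv_mul_cancel_left₀ hs0, mul_comm, mul_left_comm, mul_assoc] using h4)
      (by simpa only [inv_mul_cancel_left₀ hs0, mul_comm, mul_left_comm, mul_assoc] using h1) rb
  by_cases rc : u = s * c
  · exact eq_of_eq_left_root (inv_ne_zero hs0) hs' (hmul hc) (hmul ha) (hmul hb) (hmul hd)
      (hinj hac.symm) (hinj hbc.symm) (hinj hcd) (hinj hab) (hinj had) (hinj hbd) hk
      (by simpa only [inv_mul_cancel_left₀ hs0, mul_comm, mul_left_comm, mul_assoc] using h5)
      (by simpa only [inv_mul_cancel_left₀ hs0, mul_comm, mul_left_comm, mul_assoc] using h3)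
      (by simpa only [inv_mul_cancel_left₀ hs0, mul_comm, mul_left_comm, mul_assoc] using h1)
      (by simpa only [inv_mul_cancel_left₀ hs0, mul_comm, mul_left_comm, mul_assoc] using h6)
      (by simpa only [inv_mul_cancel_left₀ hs0, mul_comm, mul_left_comm, mul_assoc] using h4)
      (by simpa only [inv_mul_cancel_left₀ hs0, mul_comm, mul_left_comm, mul_assoc] using h2) rc
  by_cases rd : u = s * d
  · exact eq_of_eq_left_root (inv_ne_zero hs0) hs' (hmul hd) (hmul ha) (hmul hb) (hmul hc)
      (hinj had.symm) (hinj hbd.symm) (hinj hcd.symm) (hinj hab) (hinj hac) (hinj hbc) hk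
      (by simpa only [inv_mul_cancel_left₀ hs0, mul_comm, mul_left_comm, mul_assoc] using h4)
      (by simpa only [inv_mul_cancel_left₀ hs0, mul_comm, mul_left_comm, mul_assoc] using h2)
      (by simpa only [inv_mul_cancel_left₀ hs0, mul_comm, mul_left_comm, mul_assoc] using h1)
      (by simpa only [inv_mul_cancel_left₀ hs0, mul_comm, mul_left_comm, mul_assoc] using h6)
      (by simpa only [inv_mul_cancel_left₀ hs0, mul_comm, mul_left_comm, mul_assoc] using h5)
      (by simpa only [inv_mul_cancel_left₀ hs0, mul_comm, mul_left_comm, mul_assoc] using h3) rd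
  have h1' : (u - a) * (u - b) * (u - s * c) * (u - s * d) ≠ 0 := by
    simp only [ne_eq, mul_eq_zero, sub_eq_zero]
    tauto
  have h5' : (u - b) * (u - d) * (u - s * a) * (u - s * c) ≠ 0 := by
    simp only [ne_eq, mul_eq_zero, sub_eq_zero]
    tauto
  rw [h1] at h1'
  rw [h5] at h5'
  simp only [ne_eq, mul_eq_zero, not_or] at h1' h5'
  have hbc' := eq_or_mul_eq_of_proportional (w := a) (z := d) hs hbc h1 h2 hk
    (sub_ne_zero.mpr ea) (sub_ne_zero.mpr rd) (by tauto) (by tauto)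
  have hbd' := eq_or_mul_eq_of_proportional (w := a) (z := c) (x := b) (y := d) (u := u) (v := v)
    (k := k) hs hbd (by linear_combination h1) (by linear_combination h3) hk
    (sub_ne_zero.mpr ea) (sub_ne_zero.mpr rc) (by tauto) (by tauto)
  rcases hbc' with h | hbc'
  · exact h
  rcases hbd' with h | hbd'
  · exact h
  exact absurd (mul_left_cancel₀ (mul_ne_zero hs0 hb) (hbc'.symm.trans hbd')) hcd

theorem stmt_14 (κ0 κt κ1 κi t : ℂ)
    (hκ0 : κ0 ≠ 0) (hκt : κt ≠ 0) (hκ1 : κ1 ≠ 0) (hκi : κi ≠ 0) (ht : t ≠ 0)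
    (hκ02 : κ0 ^ 2 ≠ 1) (hκt2 : κt ^ 2 ≠ 1) (hκ12 : κ1 ^ 2 ≠ 1) (hκi2 : κi ^ 2 ≠ 1)
    (htt1 : t ≠ κt * κ1) (htt2 : t ≠ (κt * κ1)⁻¹)
    (htt3 : t ≠ κt * κ1⁻¹) (htt4 : t ≠ (κt * κ1⁻¹)⁻¹)
    (hns : ∀ e0 et e1 ei : ℤ, |e0| = 1 → |et| = 1 → |e1| = 1 → |ei| = 1 →
      κ0 ^ e0 * κt ^ et * κ1 ^ e1 * κi ^ ei ≠ 1)
    (hns' : ∀ e0 ei : ℤ, |e0| = 1 → |ei| = 1 → κ0 ^ e0 * κi ^ ei ≠ t)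
    (T12 T34 T13 T24 T14 T23 : ℂ)
    (hT12 : T12 = (κt ^ 2 - 1) * (κ1 ^ 2 - 1) * (κ0 * t - κi) * (κ0⁻¹ * t - κi))
    (hT34 : T34 = (κt ^ 2 - 1) * (κ1 ^ 2 - 1) * (κ0 * κi * t - 1) * (κ0⁻¹ * κi * t - 1))
    (hT13 : T13 = -((κt * κ1⁻¹ * t - 1) * (κt⁻¹ * κ1 * t - 1) * (κ0 * κt * κ1 - κi) * (κ0⁻¹ * κt * κ1 - κi)))
    (hT24 : T24 = -((κt * κ1⁻¹ * t - 1) * (κt⁻¹ * κ1 * t - 1) * (κ0 * κt * κ1 * κi - 1) * (κ0⁻¹ * κt * κ1 * κi - 1)))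
    (hT14 : T14 = (κt * κ1 * t - 1) * (κt⁻¹ * κ1⁻¹ * t - 1) * (κ0 * κ1 * κi - κt) * (κ0⁻¹ * κ1 * κi - κt))
    (hT23 : T23 = (κt * κ1 * t - 1) * (κt⁻¹ * κ1⁻¹ * t - 1) * (κ0 * κt * κi - κ1) * (κ0⁻¹ * κt * κi - κ1))
    (N12 N13 N14 N23 N24 N34 : ℂ → ℂ)
    (hN12 : ∀ f : ℂ, N12 f = T12 * (f - κ1) * (f - κ1⁻¹) * (f - t * κt * κi ^ 2) * (f - t * κt⁻¹ * κi ^ 2))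
    (hN13 : ∀ f : ℂ, N13 f = T13 * (f - t * κt⁻¹) * (f - κ1⁻¹) * (f - t * κt * κi ^ 2) * (f - κ1 * κi ^ 2))
    (hN14 : ∀ f : ℂ, N14 f = T14 * (f - κ1) * (f - t * κt⁻¹) * (f - t * κt * κi ^ 2) * (f - κ1⁻¹ * κi ^ 2))
    (hN23 : ∀ f : ℂ, N23 f = T23 * (f - t * κt) * (f - κ1⁻¹) * (f - t * κt⁻¹ * κi ^ 2) * (f - κ1 * κi ^ 2))
    (hN24 : ∀ f : ℂ, N24 f = T24 * (f - κ1) * (f - t * κt) * (f - t * κt⁻¹ * κi ^ 2) * (f - κ1⁻¹ * κi ^ 2))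
    (hN34 : ∀ f : ℂ, N34 f = T34 * (f - t * κt) * (f - t * κt⁻¹) * (f - κ1 * κi ^ 2) * (f - κ1⁻¹ * κi ^ 2)) :
    ∀ f1 f2 c : ℂ, f1 ≠ 0 → f2 ≠ 0 → c ≠ 0 →
      N12 f1 = c * N12 f2 → N13 f1 = c * N13 f2 → N14 f1 = c * N14 f2 →
      N23 f1 = c * N23 f2 → N24 f1 = c * N24 f2 → N34 f1 = c * N34 f2 →
      f1 = f2 := by
  intro f1 f2 c _ _ hc h12 h13 h14 h23 h24 h34
  have hs0 : κi ^ 2 ≠ 0 := pow_ne_zero 2 hκi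
  have n1 : κ1 ≠ κ1⁻¹ := fun h => hκ12 (by rw [sq]; nth_rewrite 2 [h]; field_simp)
  have n2 : t * κt ≠ t * κt⁻¹ := fun h => hκt2 (by
    have h' := mul_left_cancel₀ ht h
    rw [sq]; nth_rewrite 2 [h']; field_simp)
  have n3 : κ1 ≠ t * κt := fun h => htt4 (by rw [h]; field_simp)
  have n4 : κ1 ≠ t * κt⁻¹ := fun h => htt1 (by rw [h]; field_simp)
  have n5 : κ1⁻¹ ≠ t * κt := fun h => htt2 (by rw [mul_inv, h]; field_simp)
  have n6 : κ1⁻¹ ≠ t * κt⁻¹ := fun h => htt3 (by rw [h]; field_simp)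
  have m1 : κ1 * κt * t - 1 ≠ 0 := fun h => n5 (by
    field_simp; linear_combination -h)
  have m2 : t - κt * κ1 ≠ 0 := sub_ne_zero.mpr htt1
  have m3 : κt * t - κ1 ≠ 0 := fun h => n3 (by linear_combination -h)
  have m4 : κ1 * t - κt ≠ 0 := fun h => n6 (by field_simp; linear_combination -h)
  have q1 : κt ^ 2 - 1 ≠ 0 := sub_ne_zero.mpr hκt2
  have q2 : κ1 ^ 2 - 1 ≠ 0 := sub_ne_zero.mpr hκ12
  have a1 : κt * κ1⁻¹ * t - 1 ≠ 0 := fun h => m3 (by field_simp at h; linear_combination h)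
  have a2 : κt⁻¹ * κ1 * t - 1 ≠ 0 := fun h => m4 (by field_simp at h; linear_combination h)
  have a3 : κt * κ1 * t - 1 ≠ 0 := fun h => m1 (by linear_combination h)
  have a4 : κt⁻¹ * κ1⁻¹ * t - 1 ≠ 0 := fun h => m2 (by field_simp at h; linear_combination h)
  have b1 : κ0 * t - κi ≠ 0 := fun h => hns' (-1) 1 (by simp) (by simp) (by
    simp only [zpow_one, zpow_neg]
    field_simp at h ⊢
    linear_combination -h)
  have b2 : κ0⁻¹ * t - κi ≠ 0 := fun h => hns' 1 1 (by simp) (by simp) (by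
    simp only [zpow_one]
    field_simp at h ⊢
    linear_combination -h)
  have b3 : κ0 * κi * t - 1 ≠ 0 := fun h => hns' (-1) (-1) (by simp) (by simp) (by
    simp only [zpow_one, zpow_neg]
    field_simp at h ⊢
    linear_combination -h)
  have b4 : κ0⁻¹ * κi * t - 1 ≠ 0 := fun h => hns' 1 (-1) (by simp) (by simp) (by
    simp only [zpow_one, zpow_neg]
    field_simp at h ⊢
    linear_combination -h)
  have d1 : κ0 * κt * κ1 - κi ≠ 0 := fun h => hns 1 1 1 (-1) (by simp) (by simp) (by simp) (by simp)
      (by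
        simp only [zpow_one, zpow_neg]
        field_simp at h ⊢
        linear_combination h)
  have d2 : κ0⁻¹ * κt * κ1 - κi ≠ 0 := fun h => hns (-1) 1 1 (-1) (by simp) (by simp) (by simp) (by simp)
      (by
        simp only [zpow_one, zpow_neg]
        field_simp at h ⊢
        linear_combination h)
  have d3 : κ0 * κt * κ1 * κi - 1 ≠ 0 := fun h => hns 1 1 1 1 (by simp) (by simp) (by simp) (by simp)
      (by
        simp only [zpow_one]
        field_simp at h ⊢
        linear_combination h)
  have d4 : κ0⁻¹ * κt * κ1 * κi - 1 ≠ 0 := fun h => hns (-1) 1 1 1 (by simp) (by simp) (by simp) (by simp)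
      (by
        simp only [zpow_one, zpow_neg]
        field_simp at h ⊢
        linear_combination h)
  have d5 : κ0 * κ1 * κi - κt ≠ 0 := fun h => hns 1 (-1) 1 1 (by simp) (by simp) (by simp) (by simp)
      (by
        simp only [zpow_one, zpow_neg]
        field_simp at h ⊢
        linear_combination h)
  have d6 : κ0⁻¹ * κ1 * κi - κt ≠ 0 := fun h => hns (-1) (-1) 1 1 (by simp) (by simp) (by simp) (by simp)
      (by
        simp only [zpow_one, zpow_neg]
        field_simp at h ⊢
        linear_combination h)
  have d7 : κ0 * κt * κi - κ1 ≠ 0 := fun h => hns 1 1 (-1) 1 (by simp) (by simp) (by simp) (by simp)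
      (by
        simp only [zpow_one, zpow_neg]
        field_simp at h ⊢
        linear_combination h)
  have d8 : κ0⁻¹ * κt * κi - κ1 ≠ 0 := fun h => hns (-1) 1 (-1) 1 (by simp) (by simp) (by simp) (by simp)
      (by
        simp only [zpow_one, zpow_neg]
        field_simp at h ⊢
        linear_combination h)
  have z12 : T12 ≠ 0 := hT12 ▸
    mul_ne_zero (mul_ne_zero (mul_ne_zero q1 q2) b1) b2
  have z34 : T34 ≠ 0 := hT34 ▸
    mul_ne_zero (mul_ne_zero (mul_ne_zero q1 q2) b3) b4
  have z13 : T13 ≠ 0 := hT13 ▸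
    neg_ne_zero.mpr (mul_ne_zero (mul_ne_zero (mul_ne_zero a1 a2) d1) d2)
  have z24 : T24 ≠ 0 := hT24 ▸
    neg_ne_zero.mpr (mul_ne_zero (mul_ne_zero (mul_ne_zero a1 a2) d3) d4)
  have z14 : T14 ≠ 0 := hT14 ▸
    mul_ne_zero (mul_ne_zero (mul_ne_zero a3 a4) d5) d6
  have z23 : T23 ≠ 0 := hT23 ▸
    mul_ne_zero (mul_ne_zero (mul_ne_zero a3 a4) d7) d8
  rw [hN12, hN12] at h12
  rw [hN13, hN13] at h13
  rw [hN14, hN14] at h14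
  rw [hN23, hN23] at h23
  rw [hN24, hN24] at h24
  rw [hN34, hN34] at h34
  exact eq_of_pairwise_products_proportional (s := κi ^ 2) (a := κ1) (b := κ1⁻¹) (c := t * κt)
    (d := t * κt⁻¹) hs0 hκi2 hκ1 (inv_ne_zero hκ1) (mul_ne_zero ht hκt)
    (mul_ne_zero ht (inv_ne_zero hκt)) n1 n3 n4 n5 n6 n2 hc
    (mul_left_cancel₀ z12 (by linear_combination h12))
    (mul_left_cancel₀ z24 (by linear_combination h24))
    (mul_left_cancel₀ z14 (by linear_combination h14))
    (mul_left_cancel₀ z23 (by linear_combination h23))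
    (mul_left_cancel₀ z13 (by linear_combination h13))
    (mul_left_cancel₀ z34 (by linear_combination h34))
end

section
/- Write C^e(z) = C0 + z C1 with 2×2 complex matrices C0, C1. Then: (i) C0 = −Λ^{-1} C1 K^{-1}, where Λ = diag(λ, λ^{-1}) and K = diag(κ∞, κ∞^{-1}); and (ii) there exists c_e ∈ ℂ such that det C^e(z) = c_e (z − κ1)(z − κ1^{-1}) for all z ∈ ℂ. -/
open Matrix

theorem stmt_15 (κ1 κi lam : ℂ) (hκ1 : κ1 ≠ 0) (hκi : κi ≠ 0) (hlam : lam ≠ 0)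
    (Ce : ℂ → Matrix (Fin 2) (Fin 2) ℂ)
    (hCe : ∀ z : ℂ, Ce z =
      !![(1 - κ1 * lam * κi⁻¹) * (1 - z * lam * κi), (1 - κ1 * lam * κi) * (1 - z * lam * κi⁻¹);
         (1 - κ1 * lam⁻¹ * κi⁻¹) * (1 - z * lam⁻¹ * κi), (1 - κ1 * lam⁻¹ * κi) * (1 - z * lam⁻¹ * κi⁻¹)])
    (C0 C1 : Matrix (Fin 2) (Fin 2) ℂ)
    (hC01 : ∀ z : ℂ, Ce z = C0 + z • C1) :
    C0 = -((!![lam, 0; 0, lam⁻¹])⁻¹ * C1 * (!![κi, 0; 0, κi⁻¹])⁻¹) ∧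
    ∃ ce : ℂ, ∀ z : ℂ, (Ce z).det = ce * (z - κ1) * (z - κ1⁻¹) := by
  have h0 : C0 = Ce 0 := by simp [hC01]
  have h1 : C1 = Ce 1 - Ce 0 := by simp [hC01]
  have hΛ : (!![lam, 0; 0, lam⁻¹])⁻¹ = !![lam⁻¹, 0; 0, lam] :=
    Matrix.inv_eq_left_inv (by simp [Matrix.one_fin_two, hlam])
  have hK : (!![κi, 0; 0, κi⁻¹])⁻¹ = !![κi⁻¹, 0; 0, κi] :=
    Matrix.inv_eq_left_inv (by simp [Matrix.one_fin_two, hκi])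
  refine ⟨?_, (lam * κi + lam⁻¹ * κi⁻¹ - lam * κi⁻¹ - lam⁻¹ * κi) * κ1, fun z => ?_⟩
  · rw [hΛ, hK, h1, h0, hCe, hCe]
    ext i j
    fin_cases i <;> fin_cases j <;> simp <;>
      field_simp <;> ring
  · rw [hCe, Matrix.det_fin_two_of]
    field_simp
    ring
end

section
/- Write C^i(z) = C0 + z C1 with 2×2 complex matrices C0, C1. Then: (i) C0 = −t K0 C1 Λ, where K0 = diag(κ0, κ0^{-1}) and Λ = diag(λ, λ^{-1}); and (ii) there exists c_i ∈ ℂ such that det C^i(z) = c_i (z − κt t)(z − κt^{-1} t) for all z ∈ ℂ. -/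
open Matrix

theorem stmt_16 (κ0 κt t lam r : ℂ)
    (hκ0 : κ0 ≠ 0) (hκt : κt ≠ 0) (ht : t ≠ 0) (hlam : lam ≠ 0) (hr : r ≠ 0)
    (Ci : ℂ → Matrix (Fin 2) (Fin 2) ℂ)
    (hCi : ∀ z : ℂ, Ci z =
      !![r * ((1 - κt * lam * κ0⁻¹) * (1 - z * lam⁻¹ * κ0⁻¹ * t⁻¹)),
           (1 - κt * lam⁻¹ * κ0⁻¹) * (1 - z * lam * κ0⁻¹ * t⁻¹);
         r * ((1 - κt * lam * κ0) * (1 - z * lam⁻¹ * κ0 * t⁻¹)),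
           (1 - κt * lam⁻¹ * κ0) * (1 - z * lam * κ0 * t⁻¹)])
    (C0 C1 : Matrix (Fin 2) (Fin 2) ℂ)
    (hC01 : ∀ z : ℂ, Ci z = C0 + z • C1) :
    C0 = -(t • (!![κ0, 0; 0, κ0⁻¹] * C1 * !![lam, 0; 0, lam⁻¹])) ∧
    ∃ ci : ℂ, ∀ z : ℂ, (Ci z).det = ci * (z - κt * t) * (z - κt⁻¹ * t) := by
  have h0 : C0 = Ci 0 := by simp [hC01 0]
  have h1 : C1 = Ci 1 - Ci 0 := by simp [hC01]
  refine ⟨?_, (Ci 0).det / t ^ 2, fun z => ?_⟩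
  · rw [h1, h0, hCi, hCi]
    ext i j
    fin_cases i <;> fin_cases j <;>
      simp <;> field_simp <;> ring
  · rw [hCi, hCi, Matrix.det_fin_two_of, Matrix.det_fin_two_of]
    field_simp
    ring
end

section
/- For every nonzero v ∈ ℂ and each k ∈ {1, 2, 3, 4}, the limit of u^2 · ρ_k(u^{-1}, u v) as u → 0 (u ≠ 0) exists and equals κ∞ / ((κ∞^2 − 1) v w); in particular, all four crystal-limit Tyurin parameters have the same leading behaviour along the exceptional direction corresponding to the base point b8 = (∞, 0). -/
open Filter Topology

/-- If a function agrees off `0` with a quotient of functions continuous at `0`, it tends to the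
value of that quotient at `0`. -/
theorem tendsto_punctured_of_eq_div {F N D : ℂ → ℂ} {l : ℂ}
    (hF : ∀ u, u ≠ 0 → F u = N u / D u) (hN : Continuous N) (hD : Continuous D)
    (hD0 : D 0 ≠ 0) (hl : N 0 / D 0 = l) :
    Tendsto F (𝓝[≠] (0 : ℂ)) (𝓝 l) := by
  rw [← hl]
  refine Tendsto.congr' ?_
    ((hN.continuousAt.div hD.continuousAt hD0).tendsto.mono_left nhdsWithin_le_nhds)
  filter_upwards [self_mem_nhdsWithin] with u hu
  exact (hF u hu).symm

/-- Leading behaviour at `(∞, 0)` of the Tyurin parameters that are quadratic in `f`. -/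
theorem tendsto_tyurin_quadratic {k w v : ℂ} (a b c d : ℂ)
    (hw : w ≠ 0) (hk : k ^ 2 - 1 ≠ 0) (hv : v ≠ 0) {P ρ : ℂ → ℂ → ℂ}
    (hP : ∀ f g, P f g = k ^ 3 * (g - a) * (g - b) + k * (k * g - 1) ^ 2 * f ^ 2
      - k ^ 2 * f * (g - k⁻¹) * (k * c * g - d))
    (hρ : ∀ f g, ρ f g = P f g / (w * f * g * (k ^ 2 - 1))) :
    Tendsto (fun u : ℂ => u ^ 2 * ρ u⁻¹ (u * v)) (𝓝[≠] (0 : ℂ))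
      (𝓝 (k / ((k ^ 2 - 1) * v * w))) := by
  refine tendsto_punctured_of_eq_div
    (N := fun u => u ^ 2 * (k ^ 3 * (u * v - a) * (u * v - b)) + k * (k * (u * v) - 1) ^ 2
      - u * (k ^ 2 * (u * v - k⁻¹) * (k * c * (u * v) - d)))
    (D := fun _ => (k ^ 2 - 1) * v * w) ?_ (by fun_prop) (by fun_prop)
    (mul_ne_zero (mul_ne_zero hk hv) hw) (by simp)
  intro u hu
  have hden : w * u⁻¹ * (u * v) * (k ^ 2 - 1) = (k ^ 2 - 1) * v * w := by
    field_simp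
  rw [hρ, hP, hden, ← mul_div_assoc]
  congr 1
  generalize k⁻¹ = k'
  field_simp

/-- Leading behaviour at `(∞, 0)` of the Tyurin parameters that are cubic in `f`. -/
theorem tendsto_tyurin_cubic {k w v : ℂ} (a b c c' d e h : ℂ)
    (hw : w ≠ 0) (hk : k ^ 2 - 1 ≠ 0) (hv : v ≠ 0) {P ρ : ℂ → ℂ → ℂ}
    (hP : ∀ f g, P f g = k ^ 3 * g ^ 2 * (f - c) ^ 2 * (f - c')
      - k ^ 2 * g * (f - c) * ((f - a) * (f - b) + (f - c') * (f - d) - e)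
      + k * (f - h) * (f - a) * (f - b))
    (hρ : ∀ f g, ρ f g = P f g / (w * f * g * (k ^ 2 - 1) * (f - c))) :
    Tendsto (fun u : ℂ => u ^ 2 * ρ u⁻¹ (u * v)) (𝓝[≠] (0 : ℂ))
      (𝓝 (k / ((k ^ 2 - 1) * v * w))) := by
  refine tendsto_punctured_of_eq_div
    (N := fun u => k ^ 3 * (u * v) ^ 2 * (1 - u * c) ^ 2 * (1 - u * c')
      - k ^ 2 * (u * v) * (1 - u * c) *
        ((1 - u * a) * (1 - u * b) + (1 - u * c') * (1 - u * d) - u ^ 2 * e)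
      + k * (1 - u * h) * (1 - u * a) * (1 - u * b))
    (D := fun u => (k ^ 2 - 1) * v * w * (1 - u * c)) ?_ (by fun_prop) (by fun_prop)
    (by simpa using ⟨⟨hk, hv⟩, hw⟩) (by simp)
  intro u hu
  have hden : u * (w * u⁻¹ * (u * v) * (k ^ 2 - 1) * (u⁻¹ - c))
      = (k ^ 2 - 1) * v * w * (1 - u * c) := by
    field_simp
  rw [hρ, hP, ← hden, ← mul_div_assoc, ← mul_div_mul_left _ _ hu]
  congr 1
  field_simp

theorem stmt_18 (κ0 κt κ1 κi t w : ℂ)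
    (hκ0 : κ0 ≠ 0) (hκt : κt ≠ 0) (hκ1 : κ1 ≠ 0) (hκi : κi ≠ 0) (ht : t ≠ 0) (hw : w ≠ 0)
    (hκi2 : κi ^ 2 ≠ 1)
    (P1 P2 P3 P4 : ℂ → ℂ → ℂ) (Q : ℂ → ℂ → ℂ)
    (hP1 : ∀ f g : ℂ, P1 f g = κi ^ 3 * (g - κ0 * t) * (g - κ0⁻¹ * t) + κi * (κi * g - 1) ^ 2 * f ^ 2
        - κi ^ 2 * f * (g - κi⁻¹) * (κi * (κ1 + κ1⁻¹) * g - t * (κi ^ 2 * κt + κt⁻¹)))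
    (hP2 : ∀ f g : ℂ, P2 f g = κi ^ 3 * (g - κ0 * t) * (g - κ0⁻¹ * t) + κi * (κi * g - 1) ^ 2 * f ^ 2
        - κi ^ 2 * f * (g - κi⁻¹) * (κi * (κ1 + κ1⁻¹) * g - t * (κi ^ 2 * κt⁻¹ + κt)))
    (hQ : ∀ f c : ℂ, Q f c = (f - κt * t) * (f - κt⁻¹ * t) + (f - c⁻¹) * (f - c * κi ^ 2)
        - (t - κ0 * κi) * (t - κ0⁻¹ * κi))
    (hP3 : ∀ f g : ℂ, P3 f g = κi ^ 3 * g ^ 2 * (f - κ1) ^ 2 * (f - κ1⁻¹)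
        - κi ^ 2 * g * (f - κ1) * Q f κ1
        + κi * (f - κ1 * κi) * (f - κt * t) * (f - κt⁻¹ * t))
    (hP4 : ∀ f g : ℂ, P4 f g = κi ^ 3 * g ^ 2 * (f - κ1⁻¹) ^ 2 * (f - κ1)
        - κi ^ 2 * g * (f - κ1⁻¹) * Q f κ1⁻¹
        + κi * (f - κ1⁻¹ * κi) * (f - κt * t) * (f - κt⁻¹ * t))
    (ρ1 ρ2 ρ3 ρ4 : ℂ → ℂ → ℂ)
    (hρ1 : ∀ f g : ℂ, ρ1 f g = P1 f g / (w * f * g * (κi ^ 2 - 1)))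
    (hρ2 : ∀ f g : ℂ, ρ2 f g = P2 f g / (w * f * g * (κi ^ 2 - 1)))
    (hρ3 : ∀ f g : ℂ, ρ3 f g = P3 f g / (w * f * g * (κi ^ 2 - 1) * (f - κ1)))
    (hρ4 : ∀ f g : ℂ, ρ4 f g = P4 f g / (w * f * g * (κi ^ 2 - 1) * (f - κ1⁻¹))) :
    ∀ v : ℂ, v ≠ 0 →
      Tendsto (fun u : ℂ => u ^ 2 * ρ1 u⁻¹ (u * v)) (𝓝[≠] (0 : ℂ))
        (𝓝 (κi / ((κi ^ 2 - 1) * v * w))) ∧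
      Tendsto (fun u : ℂ => u ^ 2 * ρ2 u⁻¹ (u * v)) (𝓝[≠] (0 : ℂ))
        (𝓝 (κi / ((κi ^ 2 - 1) * v * w))) ∧
      Tendsto (fun u : ℂ => u ^ 2 * ρ3 u⁻¹ (u * v)) (𝓝[≠] (0 : ℂ))
        (𝓝 (κi / ((κi ^ 2 - 1) * v * w))) ∧
      Tendsto (fun u : ℂ => u ^ 2 * ρ4 u⁻¹ (u * v)) (𝓝[≠] (0 : ℂ))
        (𝓝 (κi / ((κi ^ 2 - 1) * v * w))) := by
  intro v hv
  have hk : κi ^ 2 - 1 ≠ 0 := sub_ne_zero.mpr hκi2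
  exact ⟨tendsto_tyurin_quadratic _ _ _ _ hw hk hv hP1 hρ1,
    tendsto_tyurin_quadratic _ _ _ _ hw hk hv hP2 hρ2,
    tendsto_tyurin_cubic (κt * t) (κt⁻¹ * t) κ1 κ1⁻¹ (κ1 * κi ^ 2)
      ((t - κ0 * κi) * (t - κ0⁻¹ * κi)) (κ1 * κi) hw hk hv
      (fun f g => by rw [hP3, hQ]) hρ3,
    tendsto_tyurin_cubic (κt * t) (κt⁻¹ * t) κ1⁻¹ κ1 (κ1⁻¹ * κi ^ 2)
      ((t - κ0 * κi) * (t - κ0⁻¹ * κi)) (κ1⁻¹ * κi) hw hk hv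
      (fun f g => by rw [hP4, hQ, inv_inv]) hρ4⟩
end
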